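/- arXiv:2404.14126 — 2 statements merged into one kernel-verified Lean document; each statement's English description precedes it below -/
import Mathlib

section
/- For a twisted Poisson manifold (M,Π,H), i.e., (1/2)[Π,Π]_SN = ⟨Π^{⊗3},H⟩ with H a closed 3-form, the twisted Koszul bracket b₂^H(e,e') = b₂(e,e') − H(Π(e),Π(e'),·) together with the anchor Π defines a Lie algebroid structure on T*M; in particular b₂^H satisfies the Jacobi identity. -/
open scoped BigOperators

noncomputable section

/-- Points of the local chart. -/
abbrev Pt (d : ℕ) := Fin d → ℝ

/-- Partial derivative `∂_i f` at `x`. -/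
def pd {d : ℕ} (i : Fin d) (f : Pt d → ℝ) (x : Pt d) : ℝ :=
  fderiv ℝ f x (Pi.single i 1)

/-- Lie derivative of a 1-form `e` along a vector field `X`:
`(L_X e)_μ = X^ν ∂_ν e_μ + e_ν ∂_μ X^ν`. -/
def lieD {d : ℕ} (X e : Pt d → Fin d → ℝ) : Pt d → Fin d → ℝ :=
  fun x μ => ∑ ν, (X x ν * pd ν (fun y => e y μ) x + e x ν * pd μ (fun y => X y ν) x)

/-- Action of a vector field on a function, `X f = X^ν ∂_ν f`. -/
def act {d : ℕ} (X : Pt d → Fin d → ℝ) (f : Pt d → ℝ) (x : Pt d) : ℝ :=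
  ∑ ν, X x ν * pd ν f x

/-- The vector field `Π(e)`, `(Π(e))^ν = Π^{μν} e_μ`. -/
def sharp {d : ℕ} (P : Pt d → Fin d → Fin d → ℝ) (e : Pt d → Fin d → ℝ) :
    Pt d → Fin d → ℝ :=
  fun x ν => ∑ μ, P x μ ν * e x μ

/-- Full contraction `Π(e,e') = Π^{μν} e_μ e'_ν`. -/
def pairP {d : ℕ} (P : Pt d → Fin d → Fin d → ℝ) (e e' : Pt d → Fin d → ℝ) :
    Pt d → ℝ :=
  fun x => ∑ μ, ∑ ν, P x μ ν * e x μ * e' x ν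

/-- The Koszul bracket `b₂(e,e') = L_{Π(e)}e' − L_{Π(e')}e − d(Π(e,e'))`. -/
def kb {d : ℕ} (P : Pt d → Fin d → Fin d → ℝ) (e e' : Pt d → Fin d → ℝ) :
    Pt d → Fin d → ℝ :=
  fun x μ => lieD (sharp P e) e' x μ - lieD (sharp P e') e x μ - pd μ (pairP P e e') x

/-- Smoothness of (the components of) a 1-form. -/
def SmForm {d : ℕ} (e : Pt d → Fin d → ℝ) : Prop := ∀ μ, ContDiff ℝ (⊤ : ℕ∞) (fun x => e x μ)

/-- The Lie bracket of vector fields. -/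
def lieVF {d : ℕ} (X Y : Pt d → Fin d → ℝ) : Pt d → Fin d → ℝ :=
  fun x ν => ∑ μ, (X x μ * pd μ (fun y => Y y ν) x - Y x μ * pd μ (fun y => X y ν) x)

/-- The `H`-twisted Koszul bracket
`b₂^H(e,e') = b₂(e,e') − H(Π(e),Π(e'),·)`. -/
def kbH {d : ℕ} (P : Pt d → Fin d → Fin d → ℝ)
    (H : Pt d → Fin d → Fin d → Fin d → ℝ)
    (e e' : Pt d → Fin d → ℝ) : Pt d → Fin d → ℝ :=
  fun x μ => kb P e e' x μ - ∑ α, ∑ β, H x α β μ * sharp P e x α * sharp P e' x β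

set_option linter.unusedSectionVars false

namespace TwP

section alg
variable {A : Type*} [CommRing A] [Algebra ℝ A] {d : ℕ}

/-- trilinear contraction -/
def T (H : Fin d → Fin d → Fin d → A) (u v w : Fin d → A) : A :=
  ∑ a, ∑ b, ∑ c, H a b c * u a * v b * w c

/-- basis vector -/
def dl (i : Fin d) : Fin d → A := Pi.single i 1

lemma T_add1 (H : Fin d → Fin d → Fin d → A) (u u' v w : Fin d → A) :
    T H (fun a => u a + u' a) v w = T H u v w + T H u' v w := by
  simp only [T, ← Finset.sum_add_distrib]
  refine Finset.sum_congr rfl fun a _ => Finset.sum_congr rfl fun b _ =>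
    Finset.sum_congr rfl fun c _ => by ring

lemma T_sub1 (H : Fin d → Fin d → Fin d → A) (u u' v w : Fin d → A) :
    T H (fun a => u a - u' a) v w = T H u v w - T H u' v w := by
  simp only [T, ← Finset.sum_sub_distrib]
  refine Finset.sum_congr rfl fun a _ => Finset.sum_congr rfl fun b _ =>
    Finset.sum_congr rfl fun c _ => by ring

lemma T_swap12 {H : Fin d → Fin d → Fin d → A} (h : ∀ a b c, H a b c = - H b a c)
    (u v w : Fin d → A) : T H u v w = - T H v u w := by
  simp only [T]
  rw [Finset.sum_comm]
  simp only [← Finset.sum_neg_distrib]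
  refine Finset.sum_congr rfl fun a _ => Finset.sum_congr rfl fun b _ =>
    Finset.sum_congr rfl fun c _ => by rw [h b a c]; ring

lemma T_swap23 {H : Fin d → Fin d → Fin d → A} (h : ∀ a b c, H a b c = - H a c b)
    (u v w : Fin d → A) : T H u v w = - T H u w v := by
  simp only [T]
  simp only [← Finset.sum_neg_distrib]
  refine Finset.sum_congr rfl fun a _ => ?_
  rw [Finset.sum_comm]
  refine Finset.sum_congr rfl fun b _ =>
    Finset.sum_congr rfl fun c _ => by rw [h a c b]; ring

lemma T_sum1 (H : Fin d → Fin d → Fin d → A) {ι : Type*} (s : Finset ι) (f : ι → A)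
    (u : ι → Fin d → A) (v w : Fin d → A) :
    T H (fun a => ∑ i ∈ s, f i * u i a) v w = ∑ i ∈ s, f i * T H (u i) v w := by
  simp only [T, Finset.mul_sum, Finset.sum_mul]
  rw [Finset.sum_comm' (t' := Finset.univ) (s' := fun _ => s) (by simp)]
  refine Finset.sum_congr rfl fun a _ => ?_
  rw [Finset.sum_comm' (t' := Finset.univ) (s' := fun _ => s) (by simp)]
  refine Finset.sum_congr rfl fun b _ => ?_
  rw [Finset.sum_comm' (t' := Finset.univ) (s' := fun _ => s) (by simp)]
  refine Finset.sum_congr rfl fun c _ => Finset.sum_congr rfl fun i _ => by ring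

lemma T_sum2 (H : Fin d → Fin d → Fin d → A) {ι : Type*} (s : Finset ι) (f : ι → A)
    (u : Fin d → A) (v : ι → Fin d → A) (w : Fin d → A) :
    T H u (fun a => ∑ i ∈ s, f i * v i a) w = ∑ i ∈ s, f i * T H u (v i) w := by
  simp only [T, Finset.mul_sum, Finset.sum_mul]
  rw [Finset.sum_comm' (t' := Finset.univ) (s' := fun _ => s) (by simp)]
  refine Finset.sum_congr rfl fun a _ => ?_
  rw [Finset.sum_comm' (t' := Finset.univ) (s' := fun _ => s) (by simp)]
  refine Finset.sum_congr rfl fun b _ => ?_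
  rw [Finset.sum_comm' (t' := Finset.univ) (s' := fun _ => s) (by simp)]
  refine Finset.sum_congr rfl fun c _ => Finset.sum_congr rfl fun i _ => by ring

lemma T_dl (H : Fin d → Fin d → Fin d → A) (u v : Fin d → A) (m : Fin d) :
    T H u v (dl m) = ∑ a, ∑ b, H a b m * u a * v b := by
  simp [T, dl, Pi.single_apply]

lemma T_sum3 (H : Fin d → Fin d → Fin d → A) (u v w : Fin d → A) :
    ∑ m, w m * T H u v (dl m) = T H u v w := by
  simp only [T_dl, Finset.mul_sum]
  simp only [T]
  rw [Finset.sum_comm]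
  refine Finset.sum_congr rfl fun a _ => ?_
  rw [Finset.sum_comm]
  refine Finset.sum_congr rfl fun b _ => Finset.sum_congr rfl fun c _ => by ring

lemma D_T (H : Fin d → Fin d → Fin d → A) (u v w : Fin d → A) (D : Derivation ℝ A A) :
    D (T H u v w) = T (fun a b c => D (H a b c)) u v w + T H (fun a => D (u a)) v w
      + T H u (fun a => D (v a)) w + T H u v (fun a => D (w a)) := by
  simp only [T, map_sum, ← Finset.sum_add_distrib, Derivation.leibniz, smul_eq_mul]
  refine Finset.sum_congr rfl fun a _ => Finset.sum_congr rfl fun b _ =>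
    Finset.sum_congr rfl fun c _ => by ring

lemma D_T_dl (H : Fin d → Fin d → Fin d → A) (u v : Fin d → A) (m : Fin d)
    (D : Derivation ℝ A A) :
    D (T H u v (dl m)) = T (fun a b c => D (H a b c)) u v (dl m)
      + T H (fun a => D (u a)) v (dl m) + T H u (fun a => D (v a)) (dl m) := by
  rw [D_T]
  have : (fun a => D (dl m a : A)) = fun _ => 0 := by
    funext a
    by_cases h : a = m
    · subst h; simp [dl]
    · simp [dl, h]
  rw [this]
  simp [T]

/-- derivative along a vector -/
def av (D : Fin d → Derivation ℝ A A) (X : Fin d → A) (f : A) : A := ∑ n, X n * D n f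

lemma av_add (D : Fin d → Derivation ℝ A A) (X : Fin d → A) (f g : A) :
    av D X (f + g) = av D X f + av D X g := by
  simp [av, mul_add, Finset.sum_add_distrib]

lemma av_sub (D : Fin d → Derivation ℝ A A) (X : Fin d → A) (f g : A) :
    av D X (f - g) = av D X f - av D X g := by
  simp [av, mul_sub, Finset.sum_sub_distrib]

lemma av_sum (D : Fin d → Derivation ℝ A A) (X : Fin d → A) {ι : Type*} (s : Finset ι)
    (f : ι → A) : av D X (∑ i ∈ s, f i) = ∑ i ∈ s, av D X (f i) := by
  simp only [av, map_sum, Finset.mul_sum]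
  rw [Finset.sum_comm]

lemma av_mul (D : Fin d → Derivation ℝ A A) (X : Fin d → A) (f g : A) :
    av D X (f * g) = f * av D X g + g * av D X f := by
  simp only [av, Derivation.leibniz, smul_eq_mul, Finset.mul_sum, ← Finset.sum_add_distrib]
  exact Finset.sum_congr rfl fun a _ => by ring

lemma av_lie (D : Fin d → Derivation ℝ A A) (hD : ∀ i j a, D i (D j a) = D j (D i a))
    (X Y : Fin d → A) (f : A) :
    av D (fun n => av D X (Y n) - av D Y (X n)) f = av D X (av D Y f) - av D Y (av D X f) := by
  have key : ∀ X Y : Fin d → A, av D X (av D Y f) =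
      (∑ n, av D X (Y n) * D n f) + ∑ m, ∑ n, X m * Y n * D m (D n f) := by
    intro X Y
    conv_lhs => arg 3; unfold av
    rw [av_sum]
    simp only [av_mul, Finset.sum_add_distrib]
    rw [add_comm]
    congr 1
    · exact Finset.sum_congr rfl fun a _ => by ring
    · rw [Finset.sum_comm]
      refine Finset.sum_congr rfl fun a _ => ?_
      rw [av, Finset.mul_sum]
      exact Finset.sum_congr rfl fun b _ => by ring
  rw [key X Y, key Y X, Finset.sum_comm (f := fun m n => X m * Y n * D m (D n f))]
  have : ∑ y, ∑ x, X x * Y y * D x (D y f) = ∑ m, ∑ n, Y m * X n * D m (D n f) :=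
    Finset.sum_congr rfl fun a _ => Finset.sum_congr rfl fun b _ => by rw [hD]; ring
  rw [this]
  change (∑ n, (av D X (Y n) - av D Y (X n)) * D n f) = _
  simp only [sub_mul, Finset.sum_sub_distrib]
  ring

/-- structure functions -/
def cc (D : Fin d → Derivation ℝ A A) (P : Fin d → Fin d → A)
    (H : Fin d → Fin d → Fin d → A) (i j m : Fin d) : A :=
  D m (P i j) - T H (P i) (P j) (dl m)

/-- bilinear part of bracket -/
def cb (D : Fin d → Derivation ℝ A A) (P : Fin d → Fin d → A)
    (H : Fin d → Fin d → Fin d → A) (e e' : Fin d → A) (m : Fin d) : A :=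
  ∑ i, ∑ j, e i * e' j * cc D P H i j m

/-- anchor -/
def sh (P : Fin d → Fin d → A) (e : Fin d → A) (n : Fin d) : A := ∑ m, P m n * e m

/-- bracket -/
def br (D : Fin d → Derivation ℝ A A) (P : Fin d → Fin d → A)
    (H : Fin d → Fin d → Fin d → A) (e e' : Fin d → A) (m : Fin d) : A :=
  cb D P H e e' m + av D (sh P e) (e' m) - av D (sh P e') (e m)

variable (D : Fin d → Derivation ℝ A A) (P : Fin d → Fin d → A) (H : Fin d → Fin d → Fin d → A)

lemma cc_skew (hP : ∀ i j, P i j = - P j i) (h1 : ∀ a b c, H a b c = - H b a c)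
    (i j m : Fin d) : cc D P H i j m = - cc D P H j i m := by
  simp only [cc]
  rw [T_swap12 h1, hP i j, map_neg]; ring

lemma cc_anchor (hP : ∀ i j, P i j = - P j i)
    (htw : ∀ k l n, ∑ m, (P m k * D m (P l n) + P m l * D m (P n k) + P m n * D m (P k l))
      = ∑ a, ∑ b, ∑ c, P a k * P b l * P c n * H a b c) (i j n : Fin d) :
    ∑ m, cc D P H i j m * P m n = av D (P i) (P j n) - av D (P j) (P i n) := by
  have h := htw i j n
  have e1 : ∑ a, ∑ b, ∑ c, P a i * P b j * P c n * H a b c = - T H (P i) (P j) (P n) := by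
    simp only [T, ← Finset.sum_neg_distrib]
    refine Finset.sum_congr rfl fun a _ => Finset.sum_congr rfl fun b _ =>
      Finset.sum_congr rfl fun c _ => by rw [hP a i, hP b j, hP c n]; ring
  rw [e1, ← T_sum3, ← Finset.sum_neg_distrib] at h
  simp only [av, cc]
  rw [← sub_eq_zero] at h ⊢
  rw [← h]
  simp only [← Finset.sum_sub_distrib]
  refine Finset.sum_congr rfl fun m _ => ?_
  rw [hP m i, hP m j, hP m n, hP n i, map_neg]
  ring

lemma closed_T (hcl : ∀ k l m n, D k (H l m n) - D l (H k m n) + D m (H k l n)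
      - D n (H k l m) = 0) (X Y Z : Fin d → A) (n : Fin d) :
    (∑ a, X a * T (fun p q r => D a (H p q r)) Y Z (dl n))
    - (∑ a, Y a * T (fun p q r => D a (H p q r)) X Z (dl n))
    + (∑ a, Z a * T (fun p q r => D a (H p q r)) X Y (dl n))
    - T (fun p q r => D n (H p q r)) X Y Z = 0 := by
  have : ∑ k, ∑ l, ∑ m, (D k (H l m n) - D l (H k m n) + D m (H k l n)
      - D n (H k l m)) * X k * Y l * Z m = 0 := by simp [hcl]
  have e1 : ∑ a, X a * T (fun p q r => D a (H p q r)) Y Z (dl n) =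
      ∑ k, ∑ l, ∑ m, D k (H l m n) * X k * Y l * Z m := by
    simp only [T_dl, Finset.mul_sum]
    exact Finset.sum_congr rfl fun a _ => Finset.sum_congr rfl fun b _ =>
      Finset.sum_congr rfl fun c _ => by ring
  have e2 : ∑ a, Y a * T (fun p q r => D a (H p q r)) X Z (dl n) =
      ∑ k, ∑ l, ∑ m, D l (H k m n) * X k * Y l * Z m := by
    simp only [T_dl, Finset.mul_sum]
    rw [Finset.sum_comm]
    exact Finset.sum_congr rfl fun a _ => Finset.sum_congr rfl fun b _ =>
      Finset.sum_congr rfl fun c _ => by ring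
  have e3 : ∑ a, Z a * T (fun p q r => D a (H p q r)) X Y (dl n) =
      ∑ k, ∑ l, ∑ m, D m (H k l n) * X k * Y l * Z m := by
    simp only [T_dl, Finset.mul_sum]
    rw [Finset.sum_comm]
    refine Finset.sum_congr rfl fun a _ => ?_
    rw [Finset.sum_comm]
    exact Finset.sum_congr rfl fun b _ => Finset.sum_congr rfl fun c _ => by ring
  have e4 : T (fun p q r => D n (H p q r)) X Y Z =
      ∑ k, ∑ l, ∑ m, D n (H k l m) * X k * Y l * Z m := rfl
  rw [e1, e2, e3, e4, ← this]
  simp only [← Finset.sum_sub_distrib, ← Finset.sum_add_distrib]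
  exact Finset.sum_congr rfl fun a _ => Finset.sum_congr rfl fun b _ =>
    Finset.sum_congr rfl fun c _ => by ring

lemma cc_term (hD : ∀ i j a, D i (D j a) = D j (D i a)) (hP : ∀ i j, P i j = - P j i)
    (htw : ∀ k l n, ∑ m, (P m k * D m (P l n) + P m l * D m (P n k) + P m n * D m (P k l))
      = ∑ a, ∑ b, ∑ c, P a k * P b l * P c n * H a b c) (i j k n : Fin d) :
    (∑ m, cc D P H i j m * cc D P H m k n) - av D (P k) (cc D P H i j n) =
      D n (av D (P i) (P j k) - av D (P j) (P i k))
      - T (fun a b c => D n (H a b c)) (P i) (P j) (P k)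
      - T H (fun a => D n (P i a)) (P j) (P k) - T H (P i) (fun a => D n (P j a)) (P k)
      + (∑ a, P k a * T (fun p q r => D a (H p q r)) (P i) (P j) (dl n))
      + T H (fun a => av D (P k) (P i a)) (P j) (dl n)
      + T H (P i) (fun a => av D (P k) (P j a)) (dl n)
      - T H (fun a => av D (P i) (P j a)) (P k) (dl n)
      + T H (fun a => av D (P j) (P i a)) (P k) (dl n) := by
  have hA := cc_anchor D P H hP htw i j
  have s1 : ∑ m, cc D P H i j m * cc D P H m k n =
      (∑ m, cc D P H i j m * D n (P m k)) - ∑ m, cc D P H i j m * T H (P m) (P k) (dl n) := by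
    rw [← Finset.sum_sub_distrib]
    exact Finset.sum_congr rfl fun m _ => by rw [cc, cc]; ring
  have s2 : ∑ m, cc D P H i j m * T H (P m) (P k) (dl n) =
      T H (fun a => av D (P i) (P j a)) (P k) (dl n)
      - T H (fun a => av D (P j) (P i a)) (P k) (dl n) := by
    rw [← T_sum1, ← T_sub1]
    simp only [hA]
  have s3 : ∑ m, cc D P H i j m * D n (P m k) =
      D n (av D (P i) (P j k) - av D (P j) (P i k)) + ∑ m, P k m * D n (cc D P H i j m) := by
    rw [← hA, map_sum, ← Finset.sum_add_distrib]
    refine Finset.sum_congr rfl fun m _ => ?_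
    rw [Derivation.leibniz, hP k m, smul_eq_mul, smul_eq_mul]; ring
  have s4 : ∑ m, P k m * D n (cc D P H i j m) - av D (P k) (cc D P H i j n) =
      (∑ m, P k m * D m (T H (P i) (P j) (dl n))) - ∑ m, P k m * D n (T H (P i) (P j) (dl m)) := by
    rw [av, ← Finset.sum_sub_distrib, ← Finset.sum_sub_distrib]
    refine Finset.sum_congr rfl fun m _ => ?_
    simp only [cc, map_sub]
    rw [hD m n]; ring
  have s5 : ∑ m, P k m * D n (T H (P i) (P j) (dl m)) =
      T (fun a b c => D n (H a b c)) (P i) (P j) (P k)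
      + T H (fun a => D n (P i a)) (P j) (P k) + T H (P i) (fun a => D n (P j a)) (P k) := by
    simp only [D_T_dl, mul_add, Finset.sum_add_distrib, T_sum3]
  have s6 : ∑ m, P k m * D m (T H (P i) (P j) (dl n)) =
      (∑ a, P k a * T (fun p q r => D a (H p q r)) (P i) (P j) (dl n))
      + T H (fun a => av D (P k) (P i a)) (P j) (dl n)
      + T H (P i) (fun a => av D (P k) (P j a)) (dl n) := by
    simp only [D_T_dl, mul_add, Finset.sum_add_distrib, av, T_sum1, T_sum2]
  rw [s1, s2, s3]
  rw [s5, s6] at s4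
  linear_combination s4

lemma cc_jac (hD : ∀ i j a, D i (D j a) = D j (D i a)) (hP : ∀ i j, P i j = - P j i)
    (h1 : ∀ a b c, H a b c = - H b a c) (h2 : ∀ a b c, H a b c = - H a c b)
    (hcl : ∀ k l m n, D k (H l m n) - D l (H k m n) + D m (H k l n) - D n (H k l m) = 0)
    (htw : ∀ k l n, ∑ m, (P m k * D m (P l n) + P m l * D m (P n k) + P m n * D m (P k l))
      = ∑ a, ∑ b, ∑ c, P a k * P b l * P c n * H a b c) (i j k n : Fin d) :
    ((∑ m, cc D P H i j m * cc D P H m k n) - av D (P k) (cc D P H i j n))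
    + ((∑ m, cc D P H j k m * cc D P H m i n) - av D (P i) (cc D P H j k n))
    + ((∑ m, cc D P H k i m * cc D P H m j n) - av D (P j) (cc D P H k i n)) = 0 := by
  have hn : ∀ X (a b : Fin d), av D X (P a b) = - av D X (P b a) := by
    intro X a b; rw [hP a b]; simp [av]
  have hB : av D (P i) (P j k) + av D (P j) (P k i) + av D (P k) (P i j)
      = T H (P i) (P j) (P k) := by
    have h := htw i j k
    have e1 : ∑ a, ∑ b, ∑ c, P a i * P b j * P c k * H a b c = - T H (P i) (P j) (P k) := by
      simp only [T, ← Finset.sum_neg_distrib]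
      refine Finset.sum_congr rfl fun a _ => Finset.sum_congr rfl fun b _ =>
        Finset.sum_congr rfl fun c _ => by rw [hP a i, hP b j, hP c k]; ring
    rw [e1] at h
    rw [← neg_inj, ← h]
    simp only [av, ← Finset.sum_add_distrib, ← Finset.sum_neg_distrib]
    refine Finset.sum_congr rfl fun m _ => ?_
    rw [hP m i, hP m j, hP m k]; ring
  have hB' := congrArg (D n) hB
  rw [D_T] at hB'
  simp only [map_add] at hB'
  have hC := closed_T D H hcl (P i) (P j) (P k) n
  have hd1 : ∀ l, ∀ a b c, D l (H a b c) = - D l (H b a c) := by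
    intro l a b c; rw [h1 a b c, map_neg]
  have hd2 : ∀ l, ∀ a b c, D l (H a b c) = - D l (H a c b) := by
    intro l a b c; rw [h2 a b c, map_neg]
  have cyc : ∀ u v w, T H u v w = T H v w u := by
    intro u v w; rw [T_swap12 h1, T_swap23 h2]; ring
  have cycD : ∀ u v w, T (fun a b c => D n (H a b c)) u v w
      = T (fun a b c => D n (H a b c)) v w u := by
    intro u v w; rw [T_swap12 (hd1 n), T_swap23 (hd2 n)]; ring
  have ssw : ∑ a, P j a * T (fun p q r => D a (H p q r)) (P k) (P i) (dl n) =
      - ∑ a, P j a * T (fun p q r => D a (H p q r)) (P i) (P k) (dl n) := by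
    rw [← Finset.sum_neg_distrib]
    refine Finset.sum_congr rfl fun a _ => ?_
    rw [T_swap12 (hd1 a)]; ring
  rw [cc_term D P H hD hP htw, cc_term D P H hD hP htw, cc_term D P H hD hP htw]
  rw [hn (P j) i k, hn (P k) j i, hn (P i) k j, ssw]
  simp only [map_sub, map_neg]
  rw [cycD (P j) (P k) (P i), cycD (P k) (P i) (P j), cycD (P i) (P j) (P k),
    cycD (P j) (P k) (P i)] 
  rw [T_swap12 h1 (P i) (fun a => av D (P k) (P j a)),
    T_swap12 h1 (P j) (fun a => av D (P i) (P k a)),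
    T_swap12 h1 (P k) (fun a => av D (P j) (P i a))]
  rw [cycD (P i) (P j) (P k), cycD (P j) (P k) (P i)] at hC
  rw [cycD (P i) (P j) (P k), cycD (P j) (P k) (P i)] at hB'
  rw [cyc (fun a => D n (P j a)) (P k) (P i), cyc (P k) (P i) (fun a => D n (P j a)),
    cyc (P j) (fun a => D n (P k a)) (P i), cyc (fun a => D n (P k a)) (P i) (P j), 
    cyc (P k) (fun a => D n (P i a)) (P j), ]
  rw [cyc (P i) (fun a => D n (P j a)) (P k), cyc (fun a => D n (P j a)) (P k) (P i)] at hB'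
  rw [cyc (P i) (fun a => D n (P j a)) (P k), cyc (fun a => D n (P j a)) (P k) (P i)]
  linear_combination 2 * hB' + hC


lemma sh_eq (e : Fin d → A) : sh P e = fun n => ∑ i, e i * P i n := by
  funext n; exact Finset.sum_congr rfl fun _ _ => mul_comm _ _

lemma av_comb (u : Fin d → A) (Q : Fin d → Fin d → A) (f : A) :
    av D (fun n => ∑ i, u i * Q i n) f = ∑ i, u i * av D (Q i) f := by
  simp only [av, Finset.sum_mul, Finset.mul_sum]
  rw [Finset.sum_comm]
  exact Finset.sum_congr rfl fun _ _ => Finset.sum_congr rfl fun _ _ => by ring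

lemma br_skew (hP : ∀ i j, P i j = - P j i) (h1 : ∀ a b c, H a b c = - H b a c)
    (e e' : Fin d → A) (m : Fin d) : br D P H e e' m = - br D P H e' e m := by
  have : cb D P H e e' m = - cb D P H e' e m := by
    simp only [cb, ← Finset.sum_neg_distrib]
    rw [Finset.sum_comm]
    exact Finset.sum_congr rfl fun i _ => Finset.sum_congr rfl fun j _ => by
      rw [cc_skew D P H hP h1 j i]; ring
  simp only [br, this]; ring

lemma br_leibniz (e e' : Fin d → A) (f : A) (m : Fin d) :
    br D P H e (fun n => f * e' n) m = f * br D P H e e' m + av D (sh P e) f * e' m := by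
  have h1 : cb D P H e (fun n => f * e' n) m = f * cb D P H e e' m := by
    simp only [cb, Finset.mul_sum]
    exact Finset.sum_congr rfl fun i _ => Finset.sum_congr rfl fun j _ => by ring
  have h2 : av D (sh P (fun n => f * e' n)) (e m) = f * av D (sh P e') (e m) := by
    rw [sh_eq, sh_eq, av_comb, av_comb]
    simp only [Finset.mul_sum, mul_assoc]
  simp only [br, h1, h2, av_mul]; ring

lemma br_anchor (hP : ∀ i j, P i j = - P j i)
    (htw : ∀ k l n, ∑ m, (P m k * D m (P l n) + P m l * D m (P n k) + P m n * D m (P k l))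
      = ∑ a, ∑ b, ∑ c, P a k * P b l * P c n * H a b c) (e e' : Fin d → A) (n : Fin d) :
    sh P (br D P H e e') n
      = av D (sh P e) (sh P e' n) - av D (sh P e') (sh P e n) := by
  have hA := cc_anchor D P H hP htw
  have h1 : ∑ m, cb D P H e e' m * P m n =
      ∑ i, ∑ j, e i * e' j * (av D (P i) (P j n) - av D (P j) (P i n)) := by
    simp only [← hA, cb, Finset.mul_sum, Finset.sum_mul]
    rw [Finset.sum_comm]
    refine Finset.sum_congr rfl fun i _ => ?_
    rw [Finset.sum_comm]
    exact Finset.sum_congr rfl fun j _ => Finset.sum_congr rfl fun m _ => by ring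
  have h2 : ∀ e e' : Fin d → A, av D (sh P e) (sh P e' n) =
      (∑ m, av D (sh P e) (e' m) * P m n) + ∑ i, ∑ j, e i * e' j * av D (P i) (P j n) := by
    intro e e'
    rw [sh_eq P e', av_sum]
    simp only [av_mul, Finset.sum_add_distrib]
    rw [add_comm]
    congr 1
    · exact Finset.sum_congr rfl fun _ _ => mul_comm _ _
    · rw [Finset.sum_comm]
      refine Finset.sum_congr rfl fun j _ => ?_
      rw [sh_eq, av_comb, Finset.mul_sum]
      exact Finset.sum_congr rfl fun _ _ => by ring
  have h3 : sh P (br D P H e e') n = (∑ m, cb D P H e e' m * P m n)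
      + (∑ m, av D (sh P e) (e' m) * P m n) - ∑ m, av D (sh P e') (e m) * P m n := by
    rw [sh_eq, ← Finset.sum_add_distrib, ← Finset.sum_sub_distrib]
    exact Finset.sum_congr rfl fun _ _ => by rw [br]; ring
  rw [h3, h1, h2, h2]
  rw [Finset.sum_comm (f := fun i j => e' i * e j * av D (P i) (P j n))]
  have : ∑ i, ∑ j, e i * e' j * (av D (P i) (P j n) - av D (P j) (P i n))
      = (∑ i, ∑ j, e i * e' j * av D (P i) (P j n))
        - ∑ i, ∑ j, e' j * e i * av D (P j) (P i n) := by
    simp only [← Finset.sum_sub_distrib]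
    exact Finset.sum_congr rfl fun _ _ => Finset.sum_congr rfl fun _ _ => by ring
  rw [this]; ring

lemma cb_skew (hP : ∀ i j, P i j = - P j i) (h1 : ∀ a b c, H a b c = - H b a c)
    (e e' : Fin d → A) (m : Fin d) : cb D P H e e' m = - cb D P H e' e m := by
  simp only [cb, ← Finset.sum_neg_distrib]
  rw [Finset.sum_comm]
  exact Finset.sum_congr rfl fun i _ => Finset.sum_congr rfl fun j _ => by
    rw [cc_skew D P H hP h1 j i]; ring

/-- one cyclic term of the tensorial part -/
def tt (i j k n : Fin d) : A :=
  (∑ m, cc D P H i j m * cc D P H m k n) - av D (P k) (cc D P H i j n)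

lemma br_br (hD : ∀ i j a, D i (D j a) = D j (D i a))
    (hP : ∀ i j, P i j = - P j i)
    (htw : ∀ k l n, ∑ m, (P m k * D m (P l n) + P m l * D m (P n k) + P m n * D m (P k l))
      = ∑ a, ∑ b, ∑ c, P a k * P b l * P c n * H a b c) (e e' g : Fin d → A) (n : Fin d) :
    br D P H (br D P H e e') g n =
      (∑ i, ∑ j, ∑ k, e i * e' j * g k * tt D P H i j k n)
      + cb D P H (fun m => av D (sh P e) (e' m)) g n - cb D P H (fun m => av D (sh P e') (e m)) g n
      - cb D P H (fun m => av D (sh P g) (e m)) e' n - cb D P H e (fun m => av D (sh P g) (e' m)) n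
      + (av D (sh P e) (av D (sh P e') (g n)) - av D (sh P e') (av D (sh P e) (g n)))
      - av D (sh P g) (av D (sh P e) (e' n)) + av D (sh P g) (av D (sh P e') (e n)) := by
  have a1 : sh P (br D P H e e')
      = fun n => av D (sh P e) (sh P e' n) - av D (sh P e') (sh P e n) := by
    funext n; exact br_anchor D P H hP htw e e' n
  have a2 : cb D P H (br D P H e e') g n = cb D P H (cb D P H e e') g n
      + cb D P H (fun m => av D (sh P e) (e' m)) g n
      - cb D P H (fun m => av D (sh P e') (e m)) g n := by
    conv_lhs => unfold cb
    conv_rhs => rw [cb, cb.eq_def D P H _ g, cb.eq_def D P H _ g]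
    simp only [← Finset.sum_add_distrib, ← Finset.sum_sub_distrib]
    exact Finset.sum_congr rfl fun i _ => Finset.sum_congr rfl fun j _ => by
      simp only [br]; ring
  have a3 : av D (sh P g) (cb D P H e e' n) = (∑ i, ∑ j, e i * e' j * av D (sh P g) (cc D P H i j n))
      + cb D P H (fun m => av D (sh P g) (e m)) e' n
      + cb D P H e (fun m => av D (sh P g) (e' m)) n := by
    simp only [cb, av_sum, av_mul, ← Finset.sum_add_distrib]
    exact Finset.sum_congr rfl fun i _ => Finset.sum_congr rfl fun j _ => by ring
  have a4 : (∑ i, ∑ j, ∑ k, e i * e' j * g k * tt D P H i j k n) = cb D P H (cb D P H e e') g n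
      - ∑ i, ∑ j, e i * e' j * av D (sh P g) (cc D P H i j n) := by
    have b1 : cb D P H (cb D P H e e') g n = 
        ∑ i, ∑ j, ∑ k, ∑ m, e i * e' j * g k * (cc D P H i j m * cc D P H m k n) := by
      simp only [cb, Finset.sum_mul]
      calc _ = ∑ m, ∑ i, ∑ k, ∑ j, e i * e' j * cc D P H i j m * g k * cc D P H m k n :=
            Finset.sum_congr rfl fun m _ => Finset.sum_comm
        _ = ∑ i, ∑ m, ∑ k, ∑ j, e i * e' j * cc D P H i j m * g k * cc D P H m k n :=
            Finset.sum_comm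
        _ = _ := by
            refine Finset.sum_congr rfl fun i _ => ?_
            calc _ = ∑ m, ∑ j, ∑ k, e i * e' j * cc D P H i j m * g k * cc D P H m k n :=
                  Finset.sum_congr rfl fun m _ => Finset.sum_comm
              _ = ∑ j, ∑ m, ∑ k, e i * e' j * cc D P H i j m * g k * cc D P H m k n :=
                  Finset.sum_comm
              _ = _ := by
                  refine Finset.sum_congr rfl fun j _ => ?_
                  rw [Finset.sum_comm]
                  exact Finset.sum_congr rfl fun k _ => Finset.sum_congr rfl fun m _ => by ring
    rw [b1]
    simp only [sh_eq P g, av_comb, Finset.mul_sum, ← Finset.sum_sub_distrib]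
    refine Finset.sum_congr rfl fun i _ => Finset.sum_congr rfl fun j _ =>
      Finset.sum_congr rfl fun k _ => ?_
    rw [tt, mul_sub, Finset.mul_sum]; ring
  conv_lhs => rw [br]
  rw [a1, av_lie D hD, a2, br, av_sub, av_add, a3, a4]
  ring

lemma br_jac (hD : ∀ i j a, D i (D j a) = D j (D i a)) (hP : ∀ i j, P i j = - P j i)
    (h1 : ∀ a b c, H a b c = - H b a c) (h2 : ∀ a b c, H a b c = - H a c b)
    (hcl : ∀ k l m n, D k (H l m n) - D l (H k m n) + D m (H k l n) - D n (H k l m) = 0)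
    (htw : ∀ k l n, ∑ m, (P m k * D m (P l n) + P m l * D m (P n k) + P m n * D m (P k l))
      = ∑ a, ∑ b, ∑ c, P a k * P b l * P c n * H a b c) (e e' g : Fin d → A) (n : Fin d) :
    br D P H (br D P H e e') g n + br D P H (br D P H e' g) e n
      + br D P H (br D P H g e) e' n = 0 := by
  have key : (∑ i, ∑ j, ∑ k, e i * e' j * g k * tt D P H i j k n)
      + (∑ i, ∑ j, ∑ k, e' i * g j * e k * tt D P H i j k n)
      + (∑ i, ∑ j, ∑ k, g i * e j * e' k * tt D P H i j k n) = 0 := by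
    have b2 : (∑ i, ∑ j, ∑ k, e' i * g j * e k * tt D P H i j k n)
        = ∑ i, ∑ j, ∑ k, e' j * g k * e i * tt D P H j k i n := by
      rw [Finset.sum_comm' (s' := fun _ => Finset.univ) (t' := Finset.univ) (by simp)]
      calc _ = ∑ j, ∑ k, ∑ i, e' i * g j * e k * tt D P H i j k n :=
            Finset.sum_congr rfl fun m _ => Finset.sum_comm
        _ = ∑ k, ∑ j, ∑ i, e' i * g j * e k * tt D P H i j k n := Finset.sum_comm
        _ = _ := Finset.sum_congr rfl fun m _ => Finset.sum_comm
    have b3 : (∑ i, ∑ j, ∑ k, g i * e j * e' k * tt D P H i j k n)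
        = ∑ i, ∑ j, ∑ k, g k * e i * e' j * tt D P H k i j n := by
      rw [Finset.sum_comm]
      exact Finset.sum_congr rfl fun m _ => Finset.sum_comm
    rw [b2, b3]
    simp only [← Finset.sum_add_distrib]
    refine Finset.sum_eq_zero fun i _ => Finset.sum_eq_zero fun j _ =>
      Finset.sum_eq_zero fun k _ => ?_
    have := cc_jac D P H hD hP h1 h2 hcl htw i j k n
    simp only [tt]
    linear_combination (e i * e' j * g k) * this
  rw [br_br D P H hD hP htw, br_br D P H hD hP htw, br_br D P H hD hP htw]
  rw [cb_skew D P H hP h1 e, cb_skew D P H hP h1 e', cb_skew D P H hP h1 g]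
  linear_combination key

/-- the bracket as given -/
def kA (e e' : Fin d → A) (m : Fin d) : A :=
  (∑ n, (sh P e n * D n (e' m) + e' n * D m (sh P e n)))
  - (∑ n, (sh P e' n * D n (e m) + e n * D m (sh P e' n)))
  - D m (∑ i, ∑ j, P i j * e i * e' j)
  - ∑ a, ∑ b, H a b m * sh P e a * sh P e' b

lemma kA_eq (hP : ∀ i j, P i j = - P j i) (e e' : Fin d → A) : kA D P H e e' = br D P H e e' := by
  funext m
  have a1 : ∑ a, ∑ b, H a b m * sh P e a * sh P e' b
      = ∑ i, ∑ j, e i * e' j * T H (P i) (P j) (dl m) := by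
    rw [← T_dl, sh_eq, sh_eq, T_sum1]
    simp only [T_sum2, Finset.mul_sum, mul_assoc]
  have a2 : cb D P H e e' m = (∑ i, ∑ j, e i * e' j * D m (P i j))
      - ∑ i, ∑ j, e i * e' j * T H (P i) (P j) (dl m) := by
    simp only [cb, cc, mul_sub, Finset.sum_sub_distrib]
  have a3 : ∑ n, e' n * D m (sh P e n) =
      ∑ i, ∑ j, e' j * (P i j * D m (e i) + e i * D m (P i j)) := by
    simp only [sh, map_sum, Derivation.leibniz, smul_eq_mul, Finset.mul_sum]
    rw [Finset.sum_comm]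
  have a4 : ∑ n, e n * D m (sh P e' n) =
      - ∑ i, ∑ j, e i * (P i j * D m (e' j) + e' j * D m (P i j)) := by
    simp only [sh, map_sum, Derivation.leibniz, smul_eq_mul, Finset.mul_sum,
      ← Finset.sum_neg_distrib]
    exact Finset.sum_congr rfl fun i _ => Finset.sum_congr rfl fun j _ => by
      rw [hP j i, map_neg]; ring
  have a5 : (∑ i, ∑ j, e' j * (P i j * D m (e i) + e i * D m (P i j)))
      + (∑ i, ∑ j, e i * (P i j * D m (e' j) + e' j * D m (P i j)))
      - D m (∑ i, ∑ j, P i j * e i * e' j) = ∑ i, ∑ j, e i * e' j * D m (P i j) := by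
    simp only [map_sum, Derivation.leibniz, smul_eq_mul, ← Finset.sum_add_distrib,
      ← Finset.sum_sub_distrib]
    exact Finset.sum_congr rfl fun i _ => Finset.sum_congr rfl fun j _ => by ring
  simp only [kA, br, Finset.sum_add_distrib, a1, a2, a3, a4, av]
  linear_combination a5

end alg
end TwP

namespace TwP
variable {d : ℕ}

/-- The algebra of smooth functions. -/
def Sm (d : ℕ) : Subalgebra ℝ (Pt d → ℝ) where
  carrier := {f | ContDiff ℝ (⊤ : ℕ∞) f}
  mul_mem' := by
    intro f g (hf : ContDiff ℝ (⊤ : ℕ∞) f) (hg : ContDiff ℝ (⊤ : ℕ∞) g)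
    exact hf.mul hg
  add_mem' := by
    intro f g (hf : ContDiff ℝ (⊤ : ℕ∞) f) (hg : ContDiff ℝ (⊤ : ℕ∞) g)
    exact hf.add hg
  algebraMap_mem' := by
    intro r
    exact (contDiff_const : ContDiff ℝ (⊤ : ℕ∞) (fun _ : Pt d => r))

lemma Sm_smooth (f : Sm d) : ContDiff ℝ (⊤ : ℕ∞) f.1 := f.2

lemma Sm_diff (f : Sm d) : Differentiable ℝ f.1 :=
  ContDiff.differentiable (n := ((⊤ : ℕ∞) : WithTop ℕ∞)) f.2 (by simp)

lemma pd_smooth (i : Fin d) (f : Pt d → ℝ) (hf : ContDiff ℝ (⊤ : ℕ∞) f) :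
    ContDiff ℝ (⊤ : ℕ∞) (pd i f) := by
  have : ContDiff ℝ (⊤ : ℕ∞) (fderiv ℝ f) := hf.fderiv_right (by simp)
  exact this.clm_apply contDiff_const

/-- partial derivatives as derivations -/
def Dr (i : Fin d) : Derivation ℝ (Sm d) (Sm d) :=
  Derivation.mk'
    { toFun := fun f => ⟨pd i f.1, pd_smooth i f.1 f.2⟩
      map_add' := fun f g => by
        apply Subtype.ext; funext x
        change fderiv ℝ (f.1 + g.1) x _ = fderiv ℝ f.1 x _ + fderiv ℝ g.1 x _
        rw [fderiv_add (Sm_diff f x) (Sm_diff g x)]; rfl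
      map_smul' := fun c f => by
        apply Subtype.ext; funext x
        change fderiv ℝ (c • f.1) x _ = c • fderiv ℝ f.1 x _
        rw [fderiv_const_smul (Sm_diff f x)]; rfl }
    (fun f g => by
      apply Subtype.ext; funext x
      change fderiv ℝ (f.1 * g.1) x _ = f.1 x * fderiv ℝ g.1 x _ + g.1 x * fderiv ℝ f.1 x _
      rw [fderiv_mul (Sm_diff f x) (Sm_diff g x)]; rfl)

lemma Dr_coe (i : Fin d) (f : Sm d) : (Dr i f : Pt d → ℝ) = pd i f.1 := rfl

lemma Dr_comm (i j : Fin d) (f : Sm d) : Dr i (Dr j f) = Dr j (Dr i f) := by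
  apply Subtype.ext; funext x
  have hd : DifferentiableAt ℝ (fderiv ℝ f.1) x := by
    have : ContDiff ℝ (⊤ : ℕ∞) (fderiv ℝ f.1) := (Sm_smooth f).fderiv_right (by simp)
    exact this.differentiable (by simp) x
  have key : ∀ i j : Fin d, (Dr i (Dr j f) : Pt d → ℝ) x
      = fderiv ℝ (fderiv ℝ f.1) x (Pi.single i 1) (Pi.single j 1) := by
    intro i j
    change fderiv ℝ (fun y => fderiv ℝ f.1 y (Pi.single j 1)) x (Pi.single i 1) = _
    rw [fderiv_clm_apply hd (differentiableAt_const _)]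
    simp
  rw [key, key]
  have hs : IsSymmSndFDerivAt ℝ f.1 x := by
    apply ContDiffAt.isSymmSndFDerivAt (n := ((⊤ : ℕ∞) : WithTop ℕ∞)) (ContDiff.contDiffAt f.2)
    rw [minSmoothness_of_isRCLikeNormedField]
    exact WithTop.coe_le_coe.mpr (le_top : (2 : ℕ∞) ≤ ⊤)
  exact hs _ _

/-- evaluation of a form -/
def ev (e : Fin d → Sm d) : Pt d → Fin d → ℝ := fun x i => (e i).1 x

lemma sum_coe {ι : Type*} (s : Finset ι) (f : ι → Sm d) (x : Pt d) :
    (∑ i ∈ s, f i).1 x = ∑ i ∈ s, (f i).1 x := by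
  have : (∑ i ∈ s, f i).1 = ∑ i ∈ s, (f i).1 := map_sum (Sm d).val f s
  rw [this, Finset.sum_apply]

lemma add_coe (f g : Sm d) (x : Pt d) : (f + g).1 x = f.1 x + g.1 x := rfl
lemma sub_coe (f g : Sm d) (x : Pt d) : (f - g).1 x = f.1 x - g.1 x := rfl
lemma mul_coe (f g : Sm d) (x : Pt d) : (f * g).1 x = f.1 x * g.1 x := rfl
lemma Dr_ev (i : Fin d) (f : Sm d) (x : Pt d) : (Dr i f).1 x = pd i f.1 x := rfl

lemma ev_sharp (P : Fin d → Fin d → Sm d) (e : Fin d → Sm d) :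
    sharp (fun x i j => (P i j).1 x) (ev e) = ev (sh P e) := by
  funext x n
  simp only [sharp, ev, sh, sum_coe, mul_coe]

lemma ev_act (X : Fin d → Sm d) (f : Sm d) (x : Pt d) :
    act (ev X) f.1 x = (av Dr X f).1 x := by
  simp only [act, ev, av, sum_coe, mul_coe, Dr_ev]

lemma ev_lieVF (X Y : Fin d → Sm d) (x : Pt d) (n : Fin d) :
    lieVF (ev X) (ev Y) x n = (av Dr X (Y n) - av Dr Y (X n)).1 x := by
  simp only [lieVF, ev, av, sub_coe, sum_coe, mul_coe, Dr_ev, Finset.sum_sub_distrib]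

lemma ev_kbH (P : Fin d → Fin d → Sm d) (H : Fin d → Fin d → Fin d → Sm d)
    (e e' : Fin d → Sm d) :
    kbH (fun x i j => (P i j).1 x) (fun x i j k => (H i j k).1 x) (ev e) (ev e')
      = ev (kA Dr P H e e') := by
  funext x m
  have hp : pairP (fun x i j => (P i j).1 x) (ev e) (ev e')
      = (∑ i, ∑ j, P i j * e i * e' j : Sm d).1 := by
    funext y
    simp only [pairP, ev, sum_coe, mul_coe]
  simp only [kbH, kb, lieD, ev_sharp, hp]
  simp only [ev, kA, sub_coe, sum_coe, mul_coe, add_coe, Dr_ev]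

end TwP

set_option maxHeartbeats 2000000 in
/-- for a twisted Poisson manifold `(M,Π,H)` the twisted Koszul
bracket `b₂^H` and the anchor `Π` define a Lie algebroid on `T*M`: `b₂^H` satisfies
the Jacobi identity, the Leibniz rule holds, and the anchor intertwines `b₂^H`
with the Lie bracket of vector fields. -/
theorem twisted_poisson_lie_algebroid {d : ℕ}
    (P : Pt d → Fin d → Fin d → ℝ)
    (H : Pt d → Fin d → Fin d → Fin d → ℝ)
    (hPsmooth : ∀ μ ν, ContDiff ℝ (⊤ : ℕ∞) (fun x => P x μ ν))
    (hPskew : ∀ x μ ν, P x μ ν = - P x ν μ)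
    (hHsmooth : ∀ α β γ, ContDiff ℝ (⊤ : ℕ∞) (fun x => H x α β γ))
    (hHskew₁ : ∀ x α β γ, H x α β γ = - H x β α γ)
    (hHskew₂ : ∀ x α β γ, H x α β γ = - H x α γ β)
    (hHclosed : ∀ (x : Pt d) (κ lam μ ν : Fin d),
      pd κ (fun y => H y lam μ ν) x - pd lam (fun y => H y κ μ ν) x
        + pd μ (fun y => H y κ lam ν) x - pd ν (fun y => H y κ lam μ) x = 0)
    (htwisted : ∀ (x : Pt d) (κ lam ν : Fin d),
      (∑ μ, (P x μ κ * pd μ (fun y => P y lam ν) x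
          + P x μ lam * pd μ (fun y => P y ν κ) x
          + P x μ ν * pd μ (fun y => P y κ lam) x))
        = ∑ κ' , ∑ lam' , ∑ ν' , P x κ' κ * P x lam' lam * P x ν' ν * H x κ' lam' ν') :
    (∀ (e e' e'' : Pt d → Fin d → ℝ),
      SmForm e → SmForm e' → SmForm e'' →
      ∀ x μ, kbH P H (kbH P H e e') e'' x μ + kbH P H (kbH P H e' e'') e x μ
        + kbH P H (kbH P H e'' e) e' x μ = 0)
    ∧ (∀ (e e' : Pt d → Fin d → ℝ) (f : Pt d → ℝ),
      SmForm e → SmForm e' → ContDiff ℝ (⊤ : ℕ∞) f →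
      ∀ x μ, kbH P H e (fun y ν => f y * e' y ν) x μ
        = f x * kbH P H e e' x μ + act (sharp P e) f x * e' x μ)
    ∧ (∀ (e e' : Pt d → Fin d → ℝ),
      SmForm e → SmForm e' →
      ∀ x ν, sharp P (kbH P H e e') x ν = lieVF (sharp P e) (sharp P e') x ν) := by
  obtain ⟨P', rfl⟩ : ∃ P' : Fin d → Fin d → TwP.Sm d, P = fun x i j => (P' i j).1 x :=
    ⟨fun i j => ⟨fun x => P x i j, hPsmooth i j⟩, rfl⟩
  obtain ⟨H', rfl⟩ : ∃ H' : Fin d → Fin d → Fin d → TwP.Sm d,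
      H = fun x i j k => (H' i j k).1 x :=
    ⟨fun i j k => ⟨fun x => H x i j k, hHsmooth i j k⟩, rfl⟩
  have hD := TwP.Dr_comm (d := d)
  have hP : ∀ i j, P' i j = - P' j i := fun i j => Subtype.ext (funext fun x => hPskew x i j)
  have h1 : ∀ a b c, H' a b c = - H' b a c :=
    fun a b c => Subtype.ext (funext fun x => hHskew₁ x a b c)
  have h2 : ∀ a b c, H' a b c = - H' a c b :=
    fun a b c => Subtype.ext (funext fun x => hHskew₂ x a b c)
  have hcl : ∀ k l m n, TwP.Dr k (H' l m n) - TwP.Dr l (H' k m n) + TwP.Dr m (H' k l n)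
      - TwP.Dr n (H' k l m) = 0 :=
    fun k l m n => Subtype.ext (funext fun x => hHclosed x k l m n)
  have htw : ∀ k l n, ∑ m, (P' m k * TwP.Dr m (P' l n) + P' m l * TwP.Dr m (P' n k)
      + P' m n * TwP.Dr m (P' k l))
      = ∑ a, ∑ b, ∑ c, P' a k * P' b l * P' c n * H' a b c := by
    intro k l n
    refine Subtype.ext (funext fun x => ?_)
    have := htwisted x k l n
    simp only [TwP.sum_coe, TwP.mul_coe, TwP.add_coe, TwP.Dr_ev]
    exact this
  have hbr : ∀ E E' : Fin d → TwP.Sm d, kbH (fun x i j => (P' i j).1 x) (fun x i j k => (H' i j k).1 x)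
      (TwP.ev E) (TwP.ev E')
      = TwP.ev (TwP.br TwP.Dr P' H' E E') := by
    intro E E'
    rw [← TwP.kA_eq _ _ _ hP]
    exact TwP.ev_kbH P' H' E E'
  have hsh : ∀ E : Fin d → TwP.Sm d, sharp (fun x i j => (P' i j).1 x) (TwP.ev E) = TwP.ev (TwP.sh P' E) :=
    fun E => TwP.ev_sharp P' E
  have hlift : ∀ e : Pt d → Fin d → ℝ, SmForm e → ∃ E : Fin d → TwP.Sm d, e = TwP.ev E :=
    fun e he => ⟨fun i => ⟨fun x => e x i, he i⟩, rfl⟩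
  refine ⟨?_, ?_, ?_⟩
  · intro e e' e'' he he' he'' x μ
    obtain ⟨E, rfl⟩ := hlift e he
    obtain ⟨E', rfl⟩ := hlift e' he'
    obtain ⟨E'', rfl⟩ := hlift e'' he''
    simp only [hbr]
    exact congrFun (congrArg Subtype.val
      (TwP.br_jac TwP.Dr P' H' hD hP h1 h2 hcl htw E E' E'' μ)) x
  · intro e e' f he he' hf x μ
    obtain ⟨E, rfl⟩ := hlift e he
    obtain ⟨E', rfl⟩ := hlift e' he'
    obtain ⟨F, rfl⟩ : ∃ F : TwP.Sm d, f = F.1 := ⟨⟨f, hf⟩, rfl⟩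
    have hm : (fun y ν => F.1 y * TwP.ev E' y ν) = TwP.ev (fun n => F * E' n) := rfl
    rw [hm, hbr, hbr, hsh]
    rw [TwP.ev_act]
    exact congrFun (congrArg Subtype.val (TwP.br_leibniz TwP.Dr P' H' E E' F μ)) x
  · intro e e' he he' x ν
    obtain ⟨E, rfl⟩ := hlift e he
    obtain ⟨E', rfl⟩ := hlift e' he'
    have hl := TwP.ev_lieVF (TwP.sh P' E) (TwP.sh P' E') x ν
    have hk := TwP.br_anchor TwP.Dr P' H' hP htw E E' ν
    rw [← hk] at hl
    rw [hbr E E', hsh E, hsh E', hsh (TwP.br TwP.Dr P' H' E E')]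
    exact hl.symm
end
end

section
/- In local coordinates with a (possibly torsionful) affine connection ∇ with torsionless part ∇̊, the basic n-polycurvature equals S^∇(e^{(1)},…,e^{(n+1)})X = (1/n!) X^μ e^{(1)}_{μ₁}…e^{(n+1)}_{μ_{n+1}} ( ∇_μ ∇̊_ρ R^{μ₁…μ_{n+1}} − Σ_{i=1}^{n+1} R^{μ₁…ν…μ_{n+1}} 𝓡^{μ_i}_{ρμν} ) dx^ρ, where ν replaces μ_i in R, i.e., S^∇ = −∇T^{•∇^{E_n}} − (n+1) Alt⟨R,𝓡⟩. -/
open scoped BigOperators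

noncomputable section

/-- Interior product with the de Rham differential: `(ι_X de)_μ = X^ν(∂_ν e_μ − ∂_μ e_ν)`. -/
def iotaD {d : ℕ} (X e : Pt d → Fin d → ℝ) : Pt d → Fin d → ℝ :=
  fun x μ => ∑ ν, X x ν * (pd ν (fun y => e y μ) x - pd μ (fun y => e y ν) x)

/-- The de Rham differential of a function, as a 1-form. -/
def dF {d : ℕ} (f : Pt d → ℝ) : Pt d → Fin d → ℝ := fun x μ => pd μ f x

/-- The anchor map of the `(n+1)`-vector `R` on decomposable `n`-forms:
`R(e₁∧…∧eₙ)^ν = R^{μ₁…μₙν} e₁_{μ₁}…eₙ_{μₙ}`. -/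
def Rc {d n : ℕ} (R : Pt d → (Fin (n+1) → Fin d) → ℝ)
    (f : Fin n → (Pt d → Fin d → ℝ)) : Pt d → Fin d → ℝ :=
  fun x ν => ∑ μ : Fin n → Fin d, R x (Fin.snoc μ ν) * ∏ i, f i x (μ i)

/-- Full contraction `R(e^{(1)},…,e^{(n+1)}) = R^{μ₁…μ_{n+1}} e^{(1)}_{μ₁}…e^{(n+1)}_{μ_{n+1}}`. -/
def Rfull {d n : ℕ} (R : Pt d → (Fin (n+1) → Fin d) → ℝ)
    (e : Fin (n+1) → (Pt d → Fin d → ℝ)) : Pt d → ℝ :=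
  fun x => ∑ μ : Fin (n+1) → Fin d, R x μ * ∏ i, e i x (μ i)

/-- Total antisymmetry of the component functions of a multivector field. -/
def Antisym {d m : ℕ} (R : Pt d → (Fin m → Fin d) → ℝ) : Prop :=
  ∀ (x : Pt d) (σ : Equiv.Perm (Fin m)) (μ : Fin m → Fin d),
    R x (μ ∘ σ) = ((Equiv.Perm.sign σ : ℤ) : ℝ) * R x μ

/-- Smoothness of the components of a multivector field. -/
def SmMV {d m : ℕ} (R : Pt d → (Fin m → Fin d) → ℝ) : Prop :=
  ∀ μ, ContDiff ℝ (⊤ : ℕ∞) (fun x => R x μ)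

/-- Covariant derivative of a 1-form along a vector field,
`(∇_X e)_λ = X^μ(∂_μ e_λ − Γ^ρ_{μλ} e_ρ)`. -/
def covd {d : ℕ} (Γ : Pt d → Fin d → Fin d → Fin d → ℝ)
    (X e : Pt d → Fin d → ℝ) : Pt d → Fin d → ℝ :=
  fun x lam => ∑ μ, X x μ * (pd μ (fun y => e y lam) x - ∑ ρ, Γ x ρ μ lam * e x ρ)

/-- The torsionless part `Γ̊^μ_{νρ} = Γ^μ_{(νρ)}` of the connection coefficients. -/
def Gam0 {d : ℕ} (Γ : Pt d → Fin d → Fin d → Fin d → ℝ) :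
    Pt d → Fin d → Fin d → Fin d → ℝ :=
  fun x m a b => (1/2) * (Γ x m a b + Γ x m b a)

/-- The torsion `T^μ_{νρ} = Γ^μ_{νρ} − Γ^μ_{ρν}` of the connection. -/
def Tors {d : ℕ} (Γ : Pt d → Fin d → Fin d → Fin d → ℝ) :
    Pt d → Fin d → Fin d → Fin d → ℝ :=
  fun x m a b => Γ x m a b - Γ x m b a

/-- The curvature of the affine connection,
`𝓡^σ_{ρμν} = ∂_μΓ^σ_{νρ} − ∂_νΓ^σ_{μρ} + Γ^σ_{μκ}Γ^κ_{νρ} − Γ^σ_{νκ}Γ^κ_{μρ}`. -/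
def curvR {d : ℕ} (Γ : Pt d → Fin d → Fin d → Fin d → ℝ)
    (σ ρ μ ν : Fin d) (x : Pt d) : ℝ :=
  pd μ (fun y => Γ y σ ν ρ) x - pd ν (fun y => Γ y σ μ ρ) x
    + ∑ κ, (Γ x σ μ κ * Γ x κ ν ρ - Γ x σ ν κ * Γ x κ μ ρ)

/-- The untwisted `(n+1)`-ary Koszul bracket (interior-product form). -/
def bKos {d n : ℕ} (R : Pt d → (Fin (n+1) → Fin d) → ℝ)
    (e : Fin (n+1) → (Pt d → Fin d → ℝ)) : Pt d → Fin d → ℝ :=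
  fun x μ =>
    (∑ r : Fin (n+1), (-1 : ℝ) ^ (n + r.val) * iotaD (Rc R (e ∘ r.succAbove)) (e r) x μ)
      + pd μ (Rfull R e) x

/-- The torsion twist of the `(n+1)`-ary Koszul bracket. -/
def TwTors {d n : ℕ} (Γ : Pt d → Fin d → Fin d → Fin d → ℝ)
    (R : Pt d → (Fin (n+1) → Fin d) → ℝ)
    (e : Fin (n+1) → (Pt d → Fin d → ℝ)) : Pt d → Fin d → ℝ :=
  fun x lam => (1/2) * ∑ r : Fin (n+1), (-1 : ℝ) ^ (n + r.val + 1) *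
    ∑ ρ, ∑ ν, e r x ρ * Tors Γ x ρ lam ν * Rc R (e ∘ r.succAbove) x ν

/-- The torsion-twisted `(n+1)`-ary Koszul bracket `b^T_{n+1} = b_{n+1} − Tw_{n+1}`. -/
def bKosT {d n : ℕ} (Γ : Pt d → Fin d → Fin d → Fin d → ℝ)
    (R : Pt d → (Fin (n+1) → Fin d) → ℝ)
    (e : Fin (n+1) → (Pt d → Fin d → ℝ)) : Pt d → Fin d → ℝ :=
  fun x μ => bKos R e x μ - TwTors Γ R e x μ

/-- The basic `E_n`-on-`TM` connection `∇̄^{E_n}_ê X = R(∇_X ê) + [R(ê),X]`. -/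
def DbarTM {d n : ℕ} (Γ : Pt d → Fin d → Fin d → Fin d → ℝ)
    (R : Pt d → (Fin (n+1) → Fin d) → ℝ)
    (f : Fin n → (Pt d → Fin d → ℝ)) (X : Pt d → Fin d → ℝ) : Pt d → Fin d → ℝ :=
  fun x ν =>
    (∑ i, Rc R (Function.update f i (covd Γ X (f i))) x ν) + lieVF (Rc R f) X x ν

/-- The basic `n`-polycurvature (with the torsion-twisted Koszul bracket). -/
def polyCurvT {d n : ℕ} (Γ : Pt d → Fin d → Fin d → Fin d → ℝ)
    (R : Pt d → (Fin (n+1) → Fin d) → ℝ)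
    (e : Fin (n+1) → (Pt d → Fin d → ℝ)) (X : Pt d → Fin d → ℝ) :
    Pt d → Fin d → ℝ :=
  fun x lam =>
    covd Γ X (bKosT Γ R e) x lam
      - (∑ r : Fin (n+1), (-1 : ℝ) ^ (n + r.val + 1) *
          covd Γ (DbarTM Γ R (e ∘ r.succAbove) X) (e r) x lam)
      - ∑ r : Fin (n+1), bKosT Γ R (Function.update e r (covd Γ X (e r))) x lam

/-- The tensor `∇̊_ρ R^{μ₁…μ_{n+1}}` (covariant derivative of `R` with respect to the
torsionless part of the connection), as a function of the point. -/
def sRdF {d n : ℕ} (Γ : Pt d → Fin d → Fin d → Fin d → ℝ)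
    (R : Pt d → (Fin (n+1) → Fin d) → ℝ)
    (ρ : Fin d) (μvec : Fin (n+1) → Fin d) : Pt d → ℝ :=
  fun y => pd ρ (fun z => R z μvec) y
    + ∑ i, ∑ ν, Gam0 Γ y (μvec i) ρ ν * R y (Function.update μvec i ν)

/-- The second covariant derivative `∇_μ ∇̊_ρ R^{μ₁…μ_{n+1}}`. -/
def DsRd {d n : ℕ} (Γ : Pt d → Fin d → Fin d → Fin d → ℝ)
    (R : Pt d → (Fin (n+1) → Fin d) → ℝ)
    (μ ρ : Fin d) (μvec : Fin (n+1) → Fin d) (x : Pt d) : ℝ :=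
  pd μ (sRdF Γ R ρ μvec) x
    + (∑ i, ∑ ν, Γ x (μvec i) μ ν * sRdF Γ R ρ (Function.update μvec i ν) x)
    - ∑ σ, Γ x σ μ ρ * sRdF Γ R σ μvec x

abbrev Sm {d : ℕ} (f : Pt d → ℝ) : Prop := ContDiff ℝ (⊤ : ℕ∞) f

lemma Sm.diff {d : ℕ} {f : Pt d → ℝ} (h : Sm f) (x : Pt d) : DifferentiableAt ℝ f x :=
  (ContDiff.differentiable h (by simp)) x

lemma Sm.pd {d : ℕ} {f : Pt d → ℝ} (h : Sm f) (i : Fin d) : Sm (pd i f) := by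
  have h1 : ContDiff ℝ (⊤ : ℕ∞) (fderiv ℝ f) := ContDiff.fderiv_right h (by simp)
  exact h1.clm_apply contDiff_const

lemma pd_comm {d : ℕ} {f : Pt d → ℝ} (h : Sm f) (i j : Fin d) (x : Pt d) :
    pd i (pd j f) x = pd j (pd i f) x := by
  have h1 : ContDiff ℝ (⊤ : ℕ∞) (fderiv ℝ f) := ContDiff.fderiv_right h (by simp)
  have h2 : DifferentiableAt ℝ (fderiv ℝ f) x := h1.differentiable (by simp) x
  have h3 : IsSymmSndFDerivAt ℝ f x := by
    apply ContDiffAt.isSymmSndFDerivAt (n := (⊤ : ℕ∞)) (ContDiff.contDiffAt h)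
    simp
    exact WithTop.coe_le_coe.2 (le_top : (2 : ℕ∞) ≤ ⊤)
  have key : ∀ a b : Fin d, pd a (pd b f) x = fderiv ℝ (fderiv ℝ f) x (Pi.single a 1) (Pi.single b 1) := by
    intro a b
    have : pd b f = fun y => fderiv ℝ f y (Pi.single b 1) := rfl
    rw [this, pd, fderiv_clm_apply h2 (differentiableAt_const _)]
    simp
  rw [key, key]
  exact h3 _ _

lemma pd_add {d : ℕ} {f g : Pt d → ℝ} (hf : Sm f) (hg : Sm g) (i : Fin d) (x : Pt d) :
    pd i (fun y => f y + g y) x = pd i f x + pd i g x := by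
  simp only [pd]
  rw [fderiv_fun_add (hf.diff x) (hg.diff x)]; rfl

lemma pd_sub {d : ℕ} {f g : Pt d → ℝ} (hf : Sm f) (hg : Sm g) (i : Fin d) (x : Pt d) :
    pd i (fun y => f y - g y) x = pd i f x - pd i g x := by
  simp only [pd]
  rw [fderiv_fun_sub (hf.diff x) (hg.diff x)]; rfl

lemma pd_mul {d : ℕ} {f g : Pt d → ℝ} (hf : Sm f) (hg : Sm g) (i : Fin d) (x : Pt d) :
    pd i (fun y => f y * g y) x = pd i f x * g x + f x * pd i g x := by
  simp only [pd]
  rw [fderiv_fun_mul (hf.diff x) (hg.diff x)]; simp; ring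

lemma pd_sum {d : ℕ} {ι : Type*} [Fintype ι] {f : ι → Pt d → ℝ} (hf : ∀ a, Sm (f a)) (i : Fin d)
    (x : Pt d) : pd i (fun y => ∑ a, f a y) x = ∑ a, pd i (f a) x := by
  simp only [pd]
  rw [fderiv_fun_sum (fun a _ => (hf a).diff x)]; simp

lemma Sm.sum {d : ℕ} {ι : Type*} [Fintype ι] {f : ι → Pt d → ℝ} (hf : ∀ a, Sm (f a)) :
    Sm (fun y => ∑ a, f a y) := ContDiff.sum (fun a _ => hf a)

lemma Sm.prod {d : ℕ} {ι : Type*} [Fintype ι] {f : ι → Pt d → ℝ} (hf : ∀ a, Sm (f a)) :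
    Sm (fun y => ∏ a, f a y) := contDiff_prod (fun a _ => hf a)

/-- pointwise full contraction -/
def Cn {d m : ℕ} (T : (Fin m → Fin d) → ℝ) (a : Fin m → Fin d → ℝ) : ℝ :=
  ∑ μ, T μ * ∏ i, a i (μ i)

lemma prod_upd {d m : ℕ} (a : Fin m → Fin d → ℝ) (r : Fin m) (g : Fin d → ℝ) (μ : Fin m → Fin d) :
    ∏ i, Function.update a r g i (μ i) = g (μ r) * ∏ i ∈ Finset.univ.erase r, a i (μ i) := by
  rw [← Finset.mul_prod_erase _ _ (Finset.mem_univ r)]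
  congr 1
  · simp
  · apply Finset.prod_congr rfl
    intro i hi
    rw [Function.update_of_ne (Finset.ne_of_mem_erase hi)]

lemma prod_era {d m : ℕ} (a : Fin m → Fin d → ℝ) (r : Fin m) (μ : Fin m → Fin d) :
    ∏ i, a i (μ i) = a r (μ r) * ∏ i ∈ Finset.univ.erase r, a i (μ i) := by
  rw [← Finset.mul_prod_erase _ _ (Finset.mem_univ r)]

lemma Cn_upd_add {d m : ℕ} (T : (Fin m → Fin d) → ℝ) (a : Fin m → Fin d → ℝ) (r : Fin m)
    (g h : Fin d → ℝ) : Cn T (Function.update a r (fun ν => g ν + h ν)) =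
      Cn T (Function.update a r g) + Cn T (Function.update a r h) := by
  simp only [Cn, prod_upd, ← Finset.sum_add_distrib]
  exact Finset.sum_congr rfl fun _ _ => by ring

lemma Cn_upd_sub {d m : ℕ} (T : (Fin m → Fin d) → ℝ) (a : Fin m → Fin d → ℝ) (r : Fin m)
    (g h : Fin d → ℝ) : Cn T (Function.update a r (fun ν => g ν - h ν)) =
      Cn T (Function.update a r g) - Cn T (Function.update a r h) := by
  simp only [Cn, prod_upd, ← Finset.sum_sub_distrib]
  exact Finset.sum_congr rfl fun _ _ => by ring

lemma Cn_upd_smul {d m : ℕ} (T : (Fin m → Fin d) → ℝ) (a : Fin m → Fin d → ℝ) (r : Fin m)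
    (c : ℝ) (h : Fin d → ℝ) : Cn T (Function.update a r (fun ν => c * h ν)) =
      c * Cn T (Function.update a r h) := by
  simp only [Cn, prod_upd, Finset.mul_sum]
  exact Finset.sum_congr rfl fun _ _ => by ring

lemma Cn_upd_sum {d m : ℕ} {ι : Type*} [Fintype ι] (T : (Fin m → Fin d) → ℝ) (a : Fin m → Fin d → ℝ) (r : Fin m)
    (h : ι → Fin d → ℝ) : Cn T (Function.update a r (fun ν => ∑ k, h k ν)) =
      ∑ k, Cn T (Function.update a r (h k)) := by
  simp only [Cn, prod_upd]
  rw [Finset.sum_comm]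
  exact Finset.sum_congr rfl fun _ _ => by rw [Finset.sum_mul, Finset.mul_sum]

lemma Cn_add {d m : ℕ} (T S : (Fin m → Fin d) → ℝ) (a : Fin m → Fin d → ℝ) :
    Cn (fun μ => T μ + S μ) a = Cn T a + Cn S a := by
  simp only [Cn, ← Finset.sum_add_distrib]
  exact Finset.sum_congr rfl fun _ _ => by ring

lemma Cn_sub {d m : ℕ} (T S : (Fin m → Fin d) → ℝ) (a : Fin m → Fin d → ℝ) :
    Cn (fun μ => T μ - S μ) a = Cn T a - Cn S a := by
  simp only [Cn, ← Finset.sum_sub_distrib]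
  exact Finset.sum_congr rfl fun _ _ => by ring

lemma Cn_smul {d m : ℕ} (c : ℝ) (S : (Fin m → Fin d) → ℝ) (a : Fin m → Fin d → ℝ) :
    Cn (fun μ => c * S μ) a = c * Cn S a := by
  simp only [Cn, Finset.mul_sum]
  exact Finset.sum_congr rfl fun _ _ => by ring

lemma Cn_sum {d m : ℕ} {ι : Type*} [Fintype ι] (S : ι → (Fin m → Fin d) → ℝ) (a : Fin m → Fin d → ℝ) :
    Cn (fun μ => ∑ k, S k μ) a = ∑ k, Cn (S k) a := by
  simp only [Cn]
  rw [Finset.sum_comm]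
  exact Finset.sum_congr rfl fun _ _ => by rw [Finset.sum_mul]

lemma sum_insertNth {d n : ℕ} (r : Fin (n+1)) (F : (Fin (n+1) → Fin d) → ℝ) :
    ∑ μ, F μ = ∑ ν : Fin d, ∑ μ : Fin n → Fin d, F (r.insertNth ν μ) := by
  rw [← (Fin.insertNthEquiv (fun _ => Fin d) r).sum_comp, Fintype.sum_prod_type]
  rfl

lemma erase_prod_insertNth {d n : ℕ} (r : Fin (n+1)) (a : Fin (n+1) → Fin d → ℝ) (ν : Fin d)
    (μ : Fin n → Fin d) :
    ∏ i ∈ Finset.univ.erase r, a i (r.insertNth (α := fun _ => Fin d) ν μ i) = ∏ i, a (r.succAbove i) (μ i) := by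
  have h := Fin.prod_univ_succAbove
    (fun i => Function.update a r (fun _ => 1) i (r.insertNth (α := fun _ => Fin d) ν μ i)) r
  rw [prod_upd] at h
  simpa using h

lemma Cn_contract {d n : ℕ} (T : (Fin (n+1) → Fin d) → ℝ) (G : Fin d → Fin d → ℝ) (r : Fin (n+1))
    (a : Fin (n+1) → Fin d → ℝ) :
    Cn (fun μ => ∑ ν, G (μ r) ν * T (Function.update μ r ν)) a =
      Cn T (Function.update a r (fun ν => ∑ ρ, G ρ ν * a r ρ)) := by
  simp only [Cn, prod_upd]
  rw [sum_insertNth r, sum_insertNth r]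
  simp only [prod_era a r, erase_prod_insertNth, Fin.insertNth_apply_same, Fin.update_insertNth]
  simp only [Finset.sum_mul, Finset.mul_sum]
  rw [Finset.sum_comm]
  conv_lhs => enter [2, μ]; rw [Finset.sum_comm]
  rw [Finset.sum_comm]
  exact Finset.sum_congr rfl fun _ _ => Finset.sum_congr rfl fun _ _ =>
    Finset.sum_congr rfl fun _ _ => by ring

lemma Antisym.snoc {d n : ℕ} {R : Pt d → (Fin (n+1) → Fin d) → ℝ} (hR : Antisym R) (x : Pt d)
    (r : Fin (n+1)) (ν : Fin d) (μ : Fin n → Fin d) :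
    (-1 : ℝ) ^ (n + r.val) * R x (Fin.snoc μ ν) = R x (r.insertNth ν μ) := by
  have key : ∀ p : Fin (n+1), R x (Fin.cons ν μ) = (-1 : ℝ) ^ p.val * R x (p.insertNth ν μ) := by
    intro p
    have h := hR x p.cycleRange.symm (p.insertNth ν μ)
    rw [Fin.insertNth_comp_cycleRange_symm] at h
    rw [h, Equiv.Perm.sign_symm, Fin.sign_cycleRange]
    simp
  have h1 := key r
  rw [key (Fin.last n), Fin.insertNth_last'] at h1
  simp only [Fin.val_last] at h1
  rw [pow_add, mul_right_comm, h1, mul_right_comm, ← pow_add, ← two_mul, pow_mul]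
  simp

/-- signed contraction vector field -/
def Vr {d n : ℕ} (R : Pt d → (Fin (n+1) → Fin d) → ℝ)
    (e : Fin (n+1) → (Pt d → Fin d → ℝ)) (r : Fin (n+1)) : Pt d → Fin d → ℝ :=
  fun x ν => (-1 : ℝ) ^ (n + r.val) * Rc R (e ∘ r.succAbove) x ν

lemma Vr_contract {d n : ℕ} {R : Pt d → (Fin (n+1) → Fin d) → ℝ} (hR : Antisym R)
    (e : Fin (n+1) → (Pt d → Fin d → ℝ)) (r : Fin (n+1)) (x : Pt d) (g : Fin d → ℝ) :
    ∑ ν, Vr R e r x ν * g ν = Cn (R x) (Function.update (fun i => e i x) r g) := by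
  simp only [Cn, prod_upd]
  rw [sum_insertNth r]
  apply Finset.sum_congr rfl
  intro ν _
  simp only [Vr, Rc, Finset.mul_sum, Finset.sum_mul]
  apply Finset.sum_congr rfl
  intro μ _
  rw [erase_prod_insertNth r (fun i => e i x), ← mul_assoc, hR.snoc, Fin.insertNth_apply_same]
  simp only [Function.comp]; ring

lemma pd_prod {d m : ℕ} (f : Fin m → Pt d → ℝ) (hf : ∀ i, Sm (f i)) (k : Fin d) (x : Pt d) :
    pd k (fun y => ∏ i, f i y) x = ∑ i, pd k (f i) x * ∏ j ∈ Finset.univ.erase i, f j x := by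
  simp only [pd]
  rw [(HasFDerivAt.finsetProd (u := Finset.univ) (fun i _ => ((hf i).diff x).hasFDerivAt)).fderiv]
  simp [mul_comm]

lemma pd_Cn {d m : ℕ} (T : Pt d → (Fin m → Fin d) → ℝ) (hT : ∀ μ, Sm (fun y => T y μ))
    (a : Fin m → Pt d → Fin d → ℝ) (ha : ∀ i, SmForm (a i)) (k : Fin d) (x : Pt d) :
    pd k (fun y => Cn (T y) (fun i => a i y)) x =
      Cn (fun μ => pd k (fun y => T y μ) x) (fun i => a i x) +
      ∑ i, Cn (T x) (Function.update (fun i => a i x) i (fun ν => pd k (fun y => a i y ν) x)) := by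
  simp only [Cn, prod_upd]
  rw [pd_sum (fun μ => (hT μ).mul (Sm.prod fun i => ha i (μ i))), Finset.sum_comm, ← Finset.sum_add_distrib]
  apply Finset.sum_congr rfl
  intro μ _
  rw [pd_mul (hT μ) (Sm.prod fun i => ha i (μ i)), pd_prod _ (fun i => ha i (μ i)), Finset.mul_sum]

lemma Sm_Cn {d m : ℕ} (T : Pt d → (Fin m → Fin d) → ℝ) (hT : ∀ μ, Sm (fun y => T y μ))
    (a : Fin m → Pt d → Fin d → ℝ) (ha : ∀ i, SmForm (a i)) :
    Sm (fun y => Cn (T y) (fun i => a i y)) :=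
  Sm.sum (fun μ => (hT μ).mul (Sm.prod fun i => ha i (μ i)))

lemma Sm_sRdF {d n : ℕ} {Γ : Pt d → Fin d → Fin d → Fin d → ℝ}
    (hΓ : ∀ m a b, Sm (fun x => Γ x m a b))
    {R : Pt d → (Fin (n+1) → Fin d) → ℝ} (hRsm : SmMV R) (ρ : Fin d) (μ : Fin (n+1) → Fin d) :
    Sm (sRdF Γ R ρ μ) := by
  apply ContDiff.add (Sm.pd (hRsm μ) ρ)
  refine Sm.sum fun i => Sm.sum fun ν => ContDiff.mul ?_ (hRsm _)
  exact contDiff_const.mul ((hΓ _ _ _).add (hΓ _ _ _))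

lemma Sm_covd {d : ℕ} {Γ : Pt d → Fin d → Fin d → Fin d → ℝ}
    (hΓ : ∀ m a b, Sm (fun x => Γ x m a b)) {X e : Pt d → Fin d → ℝ} (hX : SmForm X)
    (he : SmForm e) : SmForm (covd Γ X e) := fun lam =>
  Sm.sum fun μ => (hX μ).mul ((Sm.pd (he lam) μ).sub (Sm.sum fun ρ => (hΓ _ _ _).mul (he ρ)))

lemma Sm_Vr {d n : ℕ} {R : Pt d → (Fin (n+1) → Fin d) → ℝ} (hRsm : SmMV R)
    {e : Fin (n+1) → (Pt d → Fin d → ℝ)} (he : ∀ i, SmForm (e i)) (r : Fin (n+1)) :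
    SmForm (Vr R e r) := fun ν =>
  contDiff_const.mul (Sm.sum fun μ => (hRsm _).mul (Sm.prod fun i => he _ _))

lemma bKosT_eq {d n : ℕ} {Γ : Pt d → Fin d → Fin d → Fin d → ℝ}
    {R : Pt d → (Fin (n+1) → Fin d) → ℝ}
    (hR : Antisym R) (hRsm : SmMV R)
    {e : Fin (n+1) → (Pt d → Fin d → ℝ)} (he : ∀ i, SmForm (e i)) (x : Pt d) (lam : Fin d) :
    bKosT Γ R e x lam = Cn (fun μ => sRdF Γ R lam μ x) (fun i => e i x)
      + ∑ r, covd Γ (Vr R e r) (e r) x lam := by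
  have h1 : ∀ r : Fin (n+1), (-1 : ℝ) ^ (n + r.val) * iotaD (Rc R (e ∘ r.succAbove)) (e r) x lam
      = Cn (R x) (Function.update (fun i => e i x) r (fun ν => pd ν (fun y => e r y lam) x))
        - Cn (R x) (Function.update (fun i => e i x) r (fun ν => pd lam (fun y => e r y ν) x)) := by
    intro r
    rw [← Cn_upd_sub, ← Vr_contract hR]
    simp only [iotaD, Vr, Finset.mul_sum, mul_assoc]
  have h2 : pd lam (Rfull R e) x = Cn (fun μ => pd lam (fun y => R y μ) x) (fun i => e i x) +
      ∑ r, Cn (R x) (Function.update (fun i => e i x) r (fun ν => pd lam (fun y => e r y ν) x)) :=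
    pd_Cn R hRsm e he lam x
  have h3 : TwTors Γ R e x lam = ∑ r, (-(1/2) : ℝ) *
     Cn (R x) (Function.update (fun i => e i x) r (fun ν => ∑ ρ, Tors Γ x ρ lam ν * e r x ρ)) := by
    rw [TwTors, Finset.mul_sum]
    apply Finset.sum_congr rfl
    intro r _
    rw [← Vr_contract hR, Finset.sum_comm]
    simp only [Vr, Finset.mul_sum]
    refine Finset.sum_congr rfl fun _ _ => Finset.sum_congr rfl fun _ _ => ?_
    ring
  have h4 : Cn (fun μ => sRdF Γ R lam μ x) (fun i => e i x) =
      Cn (fun μ => pd lam (fun y => R y μ) x) (fun i => e i x) + ∑ r,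
       Cn (R x) (Function.update (fun i => e i x) r (fun ν => ∑ ρ, Gam0 Γ x ρ lam ν * e r x ρ)) := by
    simp only [sRdF]
    rw [Cn_add, Cn_sum]
    congr 1
    exact Finset.sum_congr rfl fun r _ =>
      Cn_contract (R x) (fun ρ ν => Gam0 Γ x ρ lam ν) r (fun i => e i x)
  have h5 : ∀ r, covd Γ (Vr R e r) (e r) x lam =
      Cn (R x) (Function.update (fun i => e i x) r (fun ν => pd ν (fun y => e r y lam) x))
      - Cn (R x) (Function.update (fun i => e i x) r (fun ν => ∑ ρ, Γ x ρ ν lam * e r x ρ)) := by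
    intro r
    rw [← Cn_upd_sub, ← Vr_contract hR]; rfl
  rw [bKosT, bKos, h2, h3, h4]
  simp only [h1, h5, Finset.sum_sub_distrib]
  have h6 : ∀ r, Cn (R x) (Function.update (fun i => e i x) r (fun ν => ∑ ρ, Gam0 Γ x ρ lam ν * e r x ρ))
      = 1/2 * Cn (R x) (Function.update (fun i => e i x) r (fun ν => ∑ ρ, Tors Γ x ρ lam ν * e r x ρ))
      + Cn (R x) (Function.update (fun i => e i x) r (fun ν => ∑ ρ, Γ x ρ ν lam * e r x ρ)) := by
    intro r
    rw [← Cn_upd_smul, ← Cn_upd_add]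
    congr 2
    funext ν
    rw [Finset.mul_sum, ← Finset.sum_add_distrib]
    exact Finset.sum_congr rfl fun _ _ => by simp only [Gam0, Tors]; ring
  simp only [h6, Finset.sum_add_distrib, ← Finset.mul_sum]
  ring

lemma covd_add {d : ℕ} {Γ : Pt d → Fin d → Fin d → Fin d → ℝ} {X f g : Pt d → Fin d → ℝ}
    (hf : SmForm f) (hg : SmForm g) (x : Pt d) (lam : Fin d) :
    covd Γ X (fun y l => f y l + g y l) x lam = covd Γ X f x lam + covd Γ X g x lam := by
  simp only [covd]
  rw [← Finset.sum_add_distrib]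
  refine Finset.sum_congr rfl fun μ _ => ?_
  rw [pd_add (hf lam) (hg lam)]
  simp only [mul_add, Finset.sum_add_distrib]
  ring

lemma covd_sum {d : ℕ} {ι : Type*} [Fintype ι] {Γ : Pt d → Fin d → Fin d → Fin d → ℝ}
    {X : Pt d → Fin d → ℝ} {g : ι → Pt d → Fin d → ℝ}
    (hg : ∀ k, SmForm (g k)) (x : Pt d) (lam : Fin d) :
    covd Γ X (fun y l => ∑ k, g k y l) x lam = ∑ k, covd Γ X (g k) x lam := by
  simp only [covd]
  rw [Finset.sum_comm]
  refine Finset.sum_congr rfl fun μ _ => ?_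
  rw [pd_sum (fun k => hg k lam), ← Finset.mul_sum, Finset.sum_sub_distrib]
  congr 2
  simp only [Finset.mul_sum]
  rw [Finset.sum_comm]

lemma covd_Cn {d n : ℕ} {Γ : Pt d → Fin d → Fin d → Fin d → ℝ}
    (hΓ : ∀ m a b, Sm (fun x => Γ x m a b))
    {R : Pt d → (Fin (n+1) → Fin d) → ℝ} (hRsm : SmMV R)
    {e : Fin (n+1) → (Pt d → Fin d → ℝ)} (he : ∀ i, SmForm (e i)) (X : Pt d → Fin d → ℝ)
    (x : Pt d) (lam : Fin d) :
    covd Γ X (fun y l => Cn (fun μ => sRdF Γ R l μ y) (fun i => e i y)) x lam =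
      ∑ k, X x k * Cn (fun μ => DsRd Γ R k lam μ x) (fun i => e i x)
      + ∑ s, Cn (fun μ => sRdF Γ R lam μ x)
          (Function.update (fun i => e i x) s (covd Γ X (e s) x)) := by
  have h1 : ∀ k, Cn (fun μ => DsRd Γ R k lam μ x) (fun i => e i x) =
      Cn (fun μ => pd k (sRdF Γ R lam μ) x) (fun i => e i x)
      + ∑ s, Cn (fun μ => sRdF Γ R lam μ x) (Function.update (fun i => e i x) s
          (fun ν => ∑ ρ, Γ x ρ k ν * e s x ρ))
      - ∑ σ, Γ x σ k lam * Cn (fun μ => sRdF Γ R σ μ x) (fun i => e i x) := by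
    intro k
    simp only [DsRd]
    rw [Cn_sub, Cn_add, Cn_sum, Cn_sum]
    simp only [Cn_smul]
    congr 2
    exact Finset.sum_congr rfl fun r _ =>
      Cn_contract (fun μ => sRdF Γ R lam μ x) (fun ρ ν => Γ x ρ k ν) r (fun i => e i x)
  have h2 : ∀ s, Cn (fun μ => sRdF Γ R lam μ x)
          (Function.update (fun i => e i x) s (covd Γ X (e s) x)) =
      ∑ k, X x k * (Cn (fun μ => sRdF Γ R lam μ x)
          (Function.update (fun i => e i x) s (fun ν => pd k (fun y => e s y ν) x))
        - Cn (fun μ => sRdF Γ R lam μ x)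
          (Function.update (fun i => e i x) s (fun ν => ∑ ρ, Γ x ρ k ν * e s x ρ))) := by
    intro s
    simp only [← Cn_upd_sub, ← Cn_upd_smul, ← Cn_upd_sum]
    rfl
  simp only [h1, h2]
  rw [Finset.sum_comm (s := (Finset.univ : Finset (Fin (n+1)))), ← Finset.sum_add_distrib]
  simp only [covd]
  refine Finset.sum_congr rfl fun k _ => ?_
  rw [pd_Cn (fun y μ => sRdF Γ R lam μ y) (fun μ => Sm_sRdF hΓ hRsm lam μ) e he k x,
    ← Finset.mul_sum, Finset.sum_sub_distrib]
  ring

/-- components of the covariant derivative -/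
def Nb {d : ℕ} (Γ : Pt d → Fin d → Fin d → Fin d → ℝ) (e : Pt d → Fin d → ℝ) (μ lam : Fin d) :
    Pt d → ℝ := fun x => pd μ (fun y => e y lam) x - ∑ ρ, Γ x ρ μ lam * e x ρ

lemma Sm_Nb {d : ℕ} {Γ : Pt d → Fin d → Fin d → Fin d → ℝ}
    (hΓ : ∀ m a b, Sm (fun x => Γ x m a b)) {e : Pt d → Fin d → ℝ}
    (he : SmForm e) (μ lam : Fin d) : Sm (Nb Γ e μ lam) :=
  (Sm.pd (he lam) μ).sub (Sm.sum fun ρ => (hΓ _ _ _).mul (he ρ))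

lemma Nb_curv {d : ℕ} {Γ : Pt d → Fin d → Fin d → Fin d → ℝ}
    (hΓ : ∀ m a b, Sm (fun x => Γ x m a b)) {e : Pt d → Fin d → ℝ}
    (he : SmForm e) (μ ν lam : Fin d) (x : Pt d) :
    (pd μ (Nb Γ e ν lam) x - ∑ ρ, Γ x ρ μ lam * Nb Γ e ν ρ x)
      - (pd ν (Nb Γ e μ lam) x - ∑ ρ, Γ x ρ ν lam * Nb Γ e μ ρ x)
      = - ∑ σ, curvR Γ σ lam μ ν x * e x σ := by
  have h : ∀ μ ν, pd μ (Nb Γ e ν lam) x = pd μ (pd ν (fun y => e y lam)) x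
      - ∑ ρ, (pd μ (fun y => Γ y ρ ν lam) x * e x ρ + Γ x ρ ν lam * pd μ (fun y => e y ρ) x) := by
    intro μ ν
    have := pd_sub (Sm.pd (he lam) ν) (Sm.sum fun ρ => (hΓ ρ ν lam).mul (he ρ)) μ x
    rw [pd_sum (fun ρ => (hΓ ρ ν lam).mul (he ρ))] at this
    simp only [pd_mul (hΓ _ _ _) (he _)] at this
    exact this
  rw [h, h, pd_comm (he lam) μ ν]
  have h2 : ∀ μ ν, ∑ ρ, Γ x ρ μ lam * Nb Γ e ν ρ x = ∑ ρ, Γ x ρ μ lam * pd ν (fun y => e y ρ) x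
     - ∑ σ, ∑ κ, Γ x σ ν κ * Γ x κ μ lam * e x σ := by
    intro μ ν
    rw [Finset.sum_comm, ← Finset.sum_sub_distrib]
    refine Finset.sum_congr rfl fun ρ _ => ?_
    rw [Nb, mul_sub, Finset.mul_sum]
    congr 1
    exact Finset.sum_congr rfl fun _ _ => by ring
  rw [h2, h2]
  simp only [curvR, add_mul, sub_mul, Finset.sum_mul, Finset.sum_add_distrib, Finset.sum_sub_distrib]
  ring

lemma covd_comm {d : ℕ} {Γ : Pt d → Fin d → Fin d → Fin d → ℝ}
    (hΓ : ∀ m a b, Sm (fun x => Γ x m a b)) {X V e : Pt d → Fin d → ℝ}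
    (hX : SmForm X) (hV : SmForm V) (he : SmForm e) (x : Pt d) (lam : Fin d) :
    covd Γ X (covd Γ V e) x lam - covd Γ V (covd Γ X e) x lam + covd Γ (lieVF V X) e x lam
      = - ∑ μ, X x μ * ∑ ν, V x ν * ∑ σ, curvR Γ σ lam μ ν x * e x σ := by
  have h : ∀ {X V : Pt d → Fin d → ℝ}, SmForm X → SmForm V →
      covd Γ X (covd Γ V e) x lam = ∑ μ, ∑ ν, X x μ * pd μ (fun y => V y ν) x * Nb Γ e ν lam x
       + ∑ μ, ∑ ν, X x μ * V x ν * (pd μ (Nb Γ e ν lam) x - ∑ ρ, Γ x ρ μ lam * Nb Γ e ν ρ x) := by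
    intro X V hX hV
    rw [← Finset.sum_add_distrib]
    refine Finset.sum_congr rfl fun μ _ => ?_
    have h1 : pd μ (fun y => covd Γ V e y lam) x =
        ∑ ν, (pd μ (fun y => V y ν) x * Nb Γ e ν lam x + V x ν * pd μ (Nb Γ e ν lam) x) := by
      have := pd_sum (fun ν => (hV ν).mul (Sm_Nb hΓ he ν lam)) μ x
      simp only [pd_mul (hV _) (Sm_Nb hΓ he _ lam)] at this
      exact this
    have h2 : ∑ ρ, Γ x ρ μ lam * covd Γ V e x ρ = ∑ ν, V x ν * ∑ ρ, Γ x ρ μ lam * Nb Γ e ν ρ x := by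
      simp only [Finset.mul_sum]
      rw [Finset.sum_comm]
      refine Finset.sum_congr rfl fun ρ _ => ?_
      rw [covd, Finset.mul_sum]
      refine Finset.sum_congr rfl fun ν _ => ?_
      rw [Nb]; ring
    rw [h1, h2, ← Finset.sum_sub_distrib, Finset.mul_sum, ← Finset.sum_add_distrib]
    exact Finset.sum_congr rfl fun _ _ => by ring
  have h3 : covd Γ (lieVF V X) e x lam =
      ∑ μ, ∑ ν, V x μ * pd μ (fun y => X y ν) x * Nb Γ e ν lam x
      - ∑ μ, ∑ ν, X x μ * pd μ (fun y => V y ν) x * Nb Γ e ν lam x := by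
    rw [← Finset.sum_sub_distrib]
    simp only [← Finset.sum_sub_distrib]
    rw [Finset.sum_comm]
    refine Finset.sum_congr rfl fun ν _ => ?_
    rw [lieVF, Finset.sum_mul]
    refine Finset.sum_congr rfl fun ν _ => ?_
    rw [Nb]; ring
  rw [h hX hV, h hV hX, h3]
  have h4 : ∑ μ, ∑ ν, V x μ * X x ν * (pd μ (Nb Γ e ν lam) x - ∑ ρ, Γ x ρ μ lam * Nb Γ e ν ρ x)
      = ∑ μ, ∑ ν, X x μ * V x ν * (pd ν (Nb Γ e μ lam) x - ∑ ρ, Γ x ρ ν lam * Nb Γ e μ ρ x) := by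
    rw [Finset.sum_comm]
    exact Finset.sum_congr rfl fun _ _ => Finset.sum_congr rfl fun _ _ => by ring
  have h5 : - ∑ μ, X x μ * ∑ ν, V x ν * ∑ σ, curvR Γ σ lam μ ν x * e x σ =
     ∑ μ, ∑ ν, X x μ * V x ν * (pd μ (Nb Γ e ν lam) x - ∑ ρ, Γ x ρ μ lam * Nb Γ e ν ρ x)
     - ∑ μ, ∑ ν, X x μ * V x ν * (pd ν (Nb Γ e μ lam) x - ∑ ρ, Γ x ρ ν lam * Nb Γ e μ ρ x) := by
    rw [← Finset.sum_sub_distrib, ← Finset.sum_neg_distrib]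
    refine Finset.sum_congr rfl fun μ _ => ?_
    rw [← Finset.sum_sub_distrib, Finset.mul_sum, ← Finset.sum_neg_distrib]
    refine Finset.sum_congr rfl fun ν _ => ?_
    rw [← mul_sub, Nb_curv hΓ he]
    ring
  rw [h4, h5]
  ring

lemma Sm_upd {d m : ℕ} {e : Fin m → (Pt d → Fin d → ℝ)} (he : ∀ i, SmForm (e i)) (s : Fin m)
    {w : Pt d → Fin d → ℝ} (hw : SmForm w) (i : Fin m) : SmForm (Function.update e s w i) := by
  by_cases h : i = s
  · subst h; simpa using hw
  · simpa [h] using he i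

lemma sum_upd_Vr {d n : ℕ} (Γ : Pt d → Fin d → Fin d → Fin d → ℝ)
    (R : Pt d → (Fin (n+1) → Fin d) → ℝ)
    (e w : Fin (n+1) → (Pt d → Fin d → ℝ)) (r : Fin (n+1)) (x : Pt d) (lam : Fin d) :
    ∑ s, covd Γ (Vr R (Function.update e s (w s)) r) (Function.update e s (w s) r) x lam
     = covd Γ (Vr R e r) (w r) x lam + (-1 : ℝ) ^ (n + r.val) * ∑ i : Fin n,
       covd Γ (Rc R (Function.update (e ∘ r.succAbove) i (w (r.succAbove i)))) (e r) x lam := by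
  rw [Fin.sum_univ_succAbove _ r]
  congr 1
  · have : Vr R (Function.update e r (w r)) r = Vr R e r := by
      have : (Function.update e r (w r)) ∘ r.succAbove = e ∘ r.succAbove := by
        funext i; simp
      funext y ν
      simp only [Vr, this]
    rw [this]; simp
  · rw [Finset.mul_sum]
    refine Finset.sum_congr rfl fun i _ => ?_
    have h1 : (Function.update e (r.succAbove i) (w (r.succAbove i))) ∘ r.succAbove =
        Function.update (e ∘ r.succAbove) i (w (r.succAbove i)) :=
      Function.update_comp_eq_of_injective _ Fin.succAbove_right_injective _ _
    have h2 : Function.update e (r.succAbove i) (w (r.succAbove i)) r = e r := by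
      rw [Function.update_of_ne (Fin.succAbove_ne r i).symm]
    rw [h2]
    simp only [covd, Vr, h1, Finset.mul_sum, mul_assoc]

lemma covd_Dbar {d n : ℕ} (Γ : Pt d → Fin d → Fin d → Fin d → ℝ)
    {R : Pt d → (Fin (n+1) → Fin d) → ℝ} (hRsm : SmMV R)
    {e : Fin (n+1) → (Pt d → Fin d → ℝ)} (he : ∀ i, SmForm (e i)) (X : Pt d → Fin d → ℝ)
    (r : Fin (n+1)) (x : Pt d) (lam : Fin d) :
    (-1 : ℝ) ^ (n + r.val) * covd Γ (DbarTM Γ R (e ∘ r.succAbove) X) (e r) x lam =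
      (-1 : ℝ) ^ (n + r.val) * (∑ i : Fin n,
       covd Γ (Rc R (Function.update (e ∘ r.succAbove) i (covd Γ X (e (r.succAbove i))))) (e r) x lam)
      + covd Γ (lieVF (Vr R e r) X) (e r) x lam := by
  have h1 : covd Γ (lieVF (Vr R e r) X) (e r) x lam =
      (-1 : ℝ) ^ (n + r.val) * covd Γ (lieVF (Rc R (e ∘ r.succAbove)) X) (e r) x lam := by
    have : ∀ ν, lieVF (Vr R e r) X x ν = (-1 : ℝ) ^ (n + r.val) * lieVF (Rc R (e ∘ r.succAbove)) X x ν := by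
      intro ν
      simp only [lieVF, Finset.mul_sum]
      refine Finset.sum_congr rfl fun μ _ => ?_
      have hs : Sm (fun y => Rc R (e ∘ r.succAbove) y ν) :=
        Sm.sum fun μ => (hRsm _).mul (Sm.prod fun i => he _ _)
      have h0 : pd μ (fun y => Vr R e r y ν) x =
          (-1 : ℝ) ^ (n + r.val) * pd μ (fun y => Rc R (e ∘ r.succAbove) y ν) x := by
        have := pd_mul (f := fun _ => (-1 : ℝ) ^ (n + r.val)) contDiff_const hs μ x
        have hc : pd μ (fun _ : Pt d => (-1 : ℝ) ^ (n + r.val)) x = 0 := by simp [pd]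
        rw [hc, zero_mul, zero_add] at this
        exact this
      rw [h0, Vr]; ring
    simp only [covd, this, Finset.mul_sum, mul_assoc]
  rw [h1, ← mul_add]
  congr 1
  simp only [covd, DbarTM]
  rw [Finset.sum_comm, ← Finset.sum_add_distrib]
  refine Finset.sum_congr rfl fun μ _ => ?_
  rw [add_mul, Finset.sum_mul]
  rfl

/-- in local coordinates, the basic `n`-polycurvature equals
`S^∇(e^{(1)},…,e^{(n+1)})X = X^μ e^{(1)}_{μ₁}…e^{(n+1)}_{μ_{n+1}}
  (∇_μ ∇̊_ρ R^{μ₁…μ_{n+1}} − Σ_i R^{μ₁…ν…μ_{n+1}} 𝓡^{μ_i}_{ρμν}) dx^ρ`,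
i.e. `S^∇ = −∇T^{•∇^{E_n}} − (n+1) Alt⟨R,𝓡⟩` (with `T^{•∇^{E_n}} = −∇̊R`). -/
theorem polycurvature_coordinate_formula {d n : ℕ} (hn : 1 ≤ n)
    (Γ : Pt d → Fin d → Fin d → Fin d → ℝ)
    (hΓsm : ∀ m a b, ContDiff ℝ (⊤ : ℕ∞) (fun x => Γ x m a b))
    (R : Pt d → (Fin (n+1) → Fin d) → ℝ)
    (hR : Antisym R) (hRsm : SmMV R)
    (e : Fin (n+1) → (Pt d → Fin d → ℝ)) (he : ∀ i, SmForm (e i))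
    (X : Pt d → Fin d → ℝ) (hX : SmForm X) :
    ∀ (x : Pt d) (ρ : Fin d),
      polyCurvT Γ R e X x ρ
        = ∑ μvec : Fin (n+1) → Fin d,
            (∑ μ, X x μ *
              (DsRd Γ R μ ρ μvec x
                - ∑ i, ∑ ν, R x (Function.update μvec i ν) * curvR Γ (μvec i) ρ μ ν x))
            * ∏ i, e i x (μvec i) := by
  intro x ρ
  have hΓ : ∀ m a b, Sm (fun x => Γ x m a b) := hΓsm
  have hw : ∀ s, SmForm (covd Γ X (e s)) := fun s => Sm_covd hΓ hX (he s)
  have hb : bKosT Γ R e = fun y l => Cn (fun μ => sRdF Γ R l μ y) (fun i => e i y)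
      + ∑ r, covd Γ (Vr R e r) (e r) y l := by
    funext y l
    exact bKosT_eq hR hRsm he y l
  have hV : ∀ r, SmForm (covd Γ (Vr R e r) (e r)) := fun r => Sm_covd hΓ (Sm_Vr hRsm he r) (he r)
  have t1 : covd Γ X (bKosT Γ R e) x ρ =
      ∑ k, X x k * Cn (fun μ => DsRd Γ R k ρ μ x) (fun i => e i x)
      + ∑ s, Cn (fun μ => sRdF Γ R ρ μ x)
          (Function.update (fun i => e i x) s (covd Γ X (e s) x))
      + ∑ r, covd Γ X (covd Γ (Vr R e r) (e r)) x ρ := by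
    rw [hb, covd_add (fun l => Sm_Cn (fun y μ => sRdF Γ R l μ y) (fun μ => Sm_sRdF hΓ hRsm l μ) e he)
      (fun l => Sm.sum fun r => hV r l), covd_Cn hΓ hRsm he, covd_sum hV]
  have t2 : ∑ r : Fin (n+1), (-1 : ℝ) ^ (n + r.val + 1) *
          covd Γ (DbarTM Γ R (e ∘ r.succAbove) X) (e r) x ρ =
      - ∑ r : Fin (n+1), ((-1 : ℝ) ^ (n + r.val) * (∑ i : Fin n,
       covd Γ (Rc R (Function.update (e ∘ r.succAbove) i (covd Γ X (e (r.succAbove i))))) (e r) x ρ)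
      + covd Γ (lieVF (Vr R e r) X) (e r) x ρ) := by
    rw [← Finset.sum_neg_distrib]
    refine Finset.sum_congr rfl fun r _ => ?_
    rw [← covd_Dbar Γ hRsm he X r x ρ, pow_succ]
    ring
  have t3 : ∑ r : Fin (n+1), bKosT Γ R (Function.update e r (covd Γ X (e r))) x ρ =
      ∑ s, Cn (fun μ => sRdF Γ R ρ μ x)
          (Function.update (fun i => e i x) s (covd Γ X (e s) x))
      + ∑ r : Fin (n+1), (covd Γ (Vr R e r) (covd Γ X (e r)) x ρ
        + (-1 : ℝ) ^ (n + r.val) * ∑ i : Fin n,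
       covd Γ (Rc R (Function.update (e ∘ r.succAbove) i (covd Γ X (e (r.succAbove i))))) (e r) x ρ) := by
    have h1 : ∀ s, bKosT Γ R (Function.update e s (covd Γ X (e s))) x ρ = 
        Cn (fun μ => sRdF Γ R ρ μ x) (Function.update (fun i => e i x) s (covd Γ X (e s) x))
        + ∑ r, covd Γ (Vr R (Function.update e s (covd Γ X (e s))) r)
          (Function.update e s (covd Γ X (e s)) r) x ρ := by
      intro s
      rw [bKosT_eq hR hRsm (Sm_upd he s (hw s))]
      congr 2
      funext i
      by_cases h : i = s
      · subst h; simp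
      · simp [h]
    simp only [h1]
    rw [Finset.sum_add_distrib, Finset.sum_comm]
    congr 1
    exact Finset.sum_congr rfl fun r _ => sum_upd_Vr Γ R e (fun s => covd Γ X (e s)) r x ρ
  have t4 : ∀ r, covd Γ X (covd Γ (Vr R e r) (e r)) x ρ
      - covd Γ (Vr R e r) (covd Γ X (e r)) x ρ + covd Γ (lieVF (Vr R e r) X) (e r) x ρ
      = - ∑ μ, X x μ * Cn (fun μv => ∑ ν, curvR Γ (μv r) ρ μ ν x * R x (Function.update μv r ν))
          (fun i => e i x) := by
    intro r
    rw [covd_comm hΓ hX (Sm_Vr hRsm he r) (he r)]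
    congr 1
    refine Finset.sum_congr rfl fun μ _ => ?_
    rw [Vr_contract hR, Cn_contract (R x) (fun σ ν => curvR Γ σ ρ μ ν x) r (fun i => e i x)]
  have t5 : ∑ r, (covd Γ X (covd Γ (Vr R e r) (e r)) x ρ
      - covd Γ (Vr R e r) (covd Γ X (e r)) x ρ + covd Γ (lieVF (Vr R e r) X) (e r) x ρ)
      = - ∑ μ, X x μ * Cn (fun μv => ∑ r, ∑ ν, R x (Function.update μv r ν) * curvR Γ (μv r) ρ μ ν x)
          (fun i => e i x) := by
    simp only [t4, Cn_sum, Finset.mul_sum, Finset.sum_neg_distrib]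
    rw [Finset.sum_comm]
    simp only [mul_comm (curvR _ _ _ _ _ _)]
  have t6 : ∑ μvec : Fin (n+1) → Fin d,
            (∑ μ, X x μ *
              (DsRd Γ R μ ρ μvec x
                - ∑ i, ∑ ν, R x (Function.update μvec i ν) * curvR Γ (μvec i) ρ μ ν x))
            * ∏ i, e i x (μvec i) = 
      ∑ μ, X x μ * Cn (fun μv => DsRd Γ R μ ρ μv x) (fun i => e i x)
      - ∑ μ, X x μ * Cn (fun μv => ∑ r, ∑ ν, R x (Function.update μv r ν) * curvR Γ (μv r) ρ μ ν x)
          (fun i => e i x) := by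
    rw [← Finset.sum_sub_distrib]
    simp only [← mul_sub, ← Cn_sub, ← Cn_smul]
    rw [← Cn_sum]
    rfl
  rw [t6, sub_eq_add_neg, ← t5, polyCurvT, t1, t2, t3]
  simp only [Finset.sum_add_distrib, Finset.sum_sub_distrib]
  ring
end
end
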